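/- Let H = ℓ²(ℕ, ℍ), m ∈ 𝕊, and let N ∈ C(H) be a densely defined closed right linear normal operator. Assume σ_S(N) = Ω_K, where K is a subset of a rectifiable curve in ℂ_m^+. Then for every ε > 0 there exist a diagonal operator D in H with D(D) = D(N) and a Hilbert–Schmidt operator S ∈ B(H) with Hilbert–Schmidt norm ‖S‖₂ < ε such that N = D + S, i.e., Nx = Dx + Sx for all x ∈ D(N). -/

import Mathlib

noncomputable section

open Quaternion Filter Topology

/-- The division ring `ℍ` of real quaternions. -/
abbrev Hq := Quaternion ℝ

/-- The quaternionic Hilbert space `H = ℓ²(ℕ, ℍ)`. -/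
abbrev Hsp := lp (fun _ : ℕ => Hq) 2

/-- Right scalar multiplication `x ↦ x · q` on `ℓ²(ℕ, ℍ)` (coordinatewise right
multiplication by the quaternion `q`). -/
def rsmul (q : Hq) (x : Hsp) : Hsp := MulOpposite.op q • x

/-- The quaternionic inner product `⟨x, y⟩ = ∑ₙ x̄ₙ yₙ`. -/
def qinner (x y : Hsp) : Hq := ∑' n, star (x n) * y n

/-- The set `𝕊` of unit imaginary quaternions. -/
def QS : Set Hq := {q | star q = -q ∧ ‖q‖ = 1}

/-- The slice complex plane `ℂ_m = {α + mβ : α, β ∈ ℝ}`. -/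
def sliceC (m : Hq) : Set Hq := {q | ∃ α β : ℝ, q = (α : Hq) + m * (β : Hq)}

/-- The closed upper half slice plane `ℂ_m⁺ = {α + mβ : α ∈ ℝ, β ≥ 0}`. -/
def sliceCplus (m : Hq) : Set Hq :=
  {q | ∃ α β : ℝ, 0 ≤ β ∧ q = (α : Hq) + m * (β : Hq)}

/-- `T : H → H` is a bounded right linear operator, i.e. `T ∈ B(H)`. -/
def IsBoundedRightLinear (T : Hsp → Hsp) : Prop :=
  (∀ x y, T (x + y) = T x + T y) ∧ (∀ q x, T (rsmul q x) = rsmul q (T x)) ∧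
    ∃ M : ℝ, ∀ x, ‖T x‖ ≤ M * ‖x‖

/-- `S` is the adjoint of the (bounded) operator `T`: `⟨y, Tx⟩ = ⟨Sy, x⟩` for all `x, y`. -/
def AdjointOf (T S : Hsp → Hsp) : Prop := ∀ x y, qinner y (T x) = qinner (S y) x

/-- `T` is anti self-adjoint: `T* = -T`. -/
def IsAntiSelfAdjoint (T : Hsp → Hsp) : Prop := AdjointOf T (fun x => -(T x))

/-- `T` is unitary: `T*T = TT* = I`. -/
def IsUnitaryOp (T : Hsp → Hsp) : Prop :=
  ∃ S, AdjointOf T S ∧ (∀ x, S (T x) = x) ∧ (∀ x, T (S x) = x)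

/-- The slice Hilbert space `H₊^{Jm} = {u ∈ H : Ju = um}`. -/
def Hplus (J : Hsp → Hsp) (m : Hq) : Set Hsp := {u | J u = rsmul m u}

/-- `H₋^{Jm} = {u ∈ H : Ju = -um}`. -/
def Hminus (J : Hsp → Hsp) (m : Hq) : Set Hsp := {u | J u = -(rsmul m u)}

/-- `e` is an orthonormal basis of the (closed subspace given by the) set `S`:
each `e r` lies in `S`, the `e r` are orthonormal, and every `x ∈ S` expands as
`x = ∑ᵣ (e r) ⟨e r, x⟩`. Taking `S = Set.univ` gives orthonormal bases of `H`. -/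
def IsONBasisOn (S : Set Hsp) (e : ℕ → Hsp) : Prop :=
  (∀ r, e r ∈ S) ∧ (∀ r s, qinner (e r) (e s) = if r = s then 1 else 0) ∧
    ∀ x ∈ S, HasSum (fun r => rsmul (qinner (e r) x) (e r)) x

/-- A (possibly unbounded) operator in `H`: a domain together with an assignment of
values (only the values on the domain are relevant). -/
structure QOp where
  dom : Set Hsp
  app : Hsp → Hsp

/-- The operator `T` is right linear: its domain is a right `ℍ`-submodule and `T`
is additive and right `ℍ`-homogeneous on it. -/
def QOp.IsRightLinear (T : QOp) : Prop :=
  (0 ∈ T.dom) ∧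
  (∀ x ∈ T.dom, ∀ y ∈ T.dom, x + y ∈ T.dom ∧ T.app (x + y) = T.app x + T.app y) ∧
  (∀ x ∈ T.dom, ∀ q : Hq, rsmul q x ∈ T.dom ∧ T.app (rsmul q x) = rsmul q (T.app x))

/-- `T` is densely defined. -/
def QOp.IsDenselyDefined (T : QOp) : Prop := Dense T.dom

/-- `T` is a closed operator: its graph is closed in `H × H`. -/
def QOp.IsClosedOp (T : QOp) : Prop :=
  IsClosed {p : Hsp × Hsp | p.1 ∈ T.dom ∧ p.2 = T.app p.1}

/-- `S` is the adjoint `T*` of `T`: the domain of `S` is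
`{y : x ↦ ⟨y, Tx⟩ is continuous on D(T)}` and `⟨y, Tx⟩ = ⟨Sy, x⟩` there. -/
def QOp.IsAdjointOf (T S : QOp) : Prop :=
  S.dom = {y | ContinuousOn (fun x => qinner y (T.app x)) T.dom} ∧
  ∀ y ∈ S.dom, ∀ x ∈ T.dom, qinner y (T.app x) = qinner (S.app y) x

/-- Composition `S ∘ T` of partial operators, with the natural domain. -/
def QOp.comp (S T : QOp) : QOp :=
  ⟨{x ∈ T.dom | T.app x ∈ S.dom}, fun x => S.app (T.app x)⟩

/-- Equality of partial operators: equal domains and equal values on the domain. -/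
def QOp.Eq (A B : QOp) : Prop := A.dom = B.dom ∧ ∀ x ∈ A.dom, A.app x = B.app x

/-- `T` is normal: `T*T = TT*` (including equality of the domains). -/
def QOp.IsNormal (T : QOp) : Prop :=
  ∃ S : QOp, T.IsAdjointOf S ∧ QOp.Eq (S.comp T) (T.comp S)

/-- `T` is compact (as an operator on the subspace `S` of `H`): the image of the
closed unit ball of `S` is relatively compact. -/
def IsCompactOn (T : Hsp → Hsp) (S : Set Hsp) : Prop :=
  IsCompact (closure (T '' (Metric.closedBall 0 1 ∩ S)))

/-- `T` has squared Hilbert–Schmidt norm `v` on the subspace `S`: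
`∑ᵣ ‖T eᵣ‖² = v` for some orthonormal basis `e` of `S`. -/
def HasHSNormSqOn (T : Hsp → Hsp) (S : Set Hsp) (v : ℝ) : Prop :=
  ∃ e : ℕ → Hsp, IsONBasisOn S e ∧ HasSum (fun r => ‖T (e r)‖ ^ 2) v

/-- `T` is diagonal: there are an orthonormal basis `{φᵣ}` of `H` contained in `D(T)`
and quaternions `qᵣ` with `Tφᵣ = φᵣ qᵣ`. -/
def QOp.IsDiagonal (T : QOp) : Prop :=
  ∃ e : ℕ → Hsp, IsONBasisOn Set.univ e ∧ (∀ r, e r ∈ T.dom) ∧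
    ∃ q : ℕ → Hq, ∀ r, T.app (e r) = rsmul (q r) (e r)

/-- The operator `Δ_q(N) = N² - N(q + q̄) + I|q|²` for a bounded operator `N`. -/
def sphDeltaB (N : Hsp → Hsp) (q : Hq) : Hsp → Hsp :=
  fun x => N (N x) - rsmul (q + star q) (N x) + rsmul ((normSq q : ℝ) : Hq) x

/-- `q` lies in the spherical resolvent of the bounded operator `N`. -/
def inSphResolventB (N : Hsp → Hsp) (q : Hq) : Prop :=
  (∀ x, sphDeltaB N q x = 0 → x = 0) ∧
  Dense (Set.range (sphDeltaB N q)) ∧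
  ∃ M : ℝ, ∀ x, ‖x‖ ≤ M * ‖sphDeltaB N q x‖

/-- The spherical spectrum of a bounded operator. -/
def sphSpectrumB (N : Hsp → Hsp) : Set Hq := {q | ¬ inSphResolventB N q}

/-- The domain `D(N²)` of the square of a partial operator. -/
def QOp.sqDom (N : QOp) : Set Hsp := {x ∈ N.dom | N.app x ∈ N.dom}

/-- The map underlying `Δ_q(N) = N² - N(q + q̄) + I|q|²`, defined on `D(N²)`. -/
def sphDeltaU (N : QOp) (q : Hq) : Hsp → Hsp :=
  fun x => N.app (N.app x) - rsmul (q + star q) (N.app x) + rsmul ((normSq q : ℝ) : Hq) x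

/-- `q` lies in the spherical resolvent of the operator `N ∈ C(H)`. -/
def inSphResolventU (N : QOp) (q : Hq) : Prop :=
  (∀ x ∈ N.sqDom, sphDeltaU N q x = 0 → x = 0) ∧
  Dense (sphDeltaU N q '' N.sqDom) ∧
  ∃ M : ℝ, ∀ x ∈ N.sqDom, ‖x‖ ≤ M * ‖sphDeltaU N q x‖

/-- The spherical spectrum of `N ∈ C(H)`. -/
def sphSpectrumU (N : QOp) : Set Hq := {q | ¬ inSphResolventU N q}

/-- The circularization `Ω_K = {α + jβ : α + mβ ∈ K, j ∈ 𝕊}` of `K ⊆ ℂ_m`. -/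
def circ (m : Hq) (K : Set Hq) : Set Hq :=
  {p | ∃ α β : ℝ, ∃ j ∈ QS, ((α : Hq) + m * (β : Hq) ∈ K) ∧ p = (α : Hq) + j * (β : Hq)}

/-- A closed densely defined normal operator `N` with domain `D` in a complex Hilbert space,
together with its adjoint `N'` with domain `D'`. -/
structure IsNormalPair {E : Type*} [NormedAddCommGroup E] [InnerProductSpace ℂ E]
    (D D' : Submodule ℂ E) (N N' : E → E) : Prop where
  map_add : ∀ x ∈ D, ∀ y ∈ D, N (x + y) = N x + N y
  map_smul : ∀ c : ℂ, ∀ x ∈ D, N (c • x) = c • N x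
  dense : Dense (D : Set E)
  closed : IsClosed {p : E × E | p.1 ∈ D ∧ p.2 = N p.1}
  mem_adj : ∀ y, (∃ C : ℝ, ∀ x ∈ D, ‖inner ℂ y (N x)‖ ≤ C * ‖x‖) → y ∈ D'
  adj : ∀ y ∈ D', ∀ x ∈ D, inner ℂ y (N x) = inner ℂ (N' y) x
  comm_dom : ∀ x, (x ∈ D ∧ N x ∈ D') ↔ (x ∈ D' ∧ N' x ∈ D)
  comm : ∀ x ∈ D, N x ∈ D' → N' (N x) = N (N' x)

namespace IsNormalPair

variable {E : Type*} [NormedAddCommGroup E] [InnerProductSpace ℂ E]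
  {D D' : Submodule ℂ E} {N N' : E → E}

lemma map_sub (h : IsNormalPair D D' N N') {x y : E} (hx : x ∈ D) (hy : y ∈ D) :
    N (x - y) = N x - N y := by
  have := h.map_add x hx ((-1 : ℂ) • y) (D.smul_mem _ hy)
  rw [h.map_smul _ y hy] at this
  simpa [sub_eq_add_neg] using this

lemma map_zero (h : IsNormalPair D D' N N') : N 0 = 0 := by
  simpa using h.map_smul 0 0 D.zero_mem

/-- The graph of `N` as a submodule of the Hilbert space `E × E`. -/
def graph (h : IsNormalPair D D' N N') : Submodule ℂ (WithLp 2 (E × E)) where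
  carrier := {p | p.fst ∈ D ∧ p.snd = N p.fst}
  add_mem' := by
    rintro a b ⟨ha, ha'⟩ ⟨hb, hb'⟩
    refine ⟨D.add_mem ha hb, ?_⟩
    simp [ha', hb', h.map_add _ ha _ hb]
  zero_mem' := by simp [h.map_zero]
  smul_mem' := by
    rintro c a ⟨ha, ha'⟩
    refine ⟨D.smul_mem c ha, ?_⟩
    simp only [WithLp.smul_snd, WithLp.smul_fst, ha', h.map_smul c _ ha]

lemma isClosed_graph (h : IsNormalPair D D' N N') :
    IsClosed (h.graph : Set (WithLp 2 (E × E))) :=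
  h.closed.preimage (WithLp.prod_continuous_ofLp 2 E E)

/-- The part of the graph of `N` lying over the domain of `N' N`. -/
def core (h : IsNormalPair D D' N N') : Submodule ℂ (WithLp 2 (E × E)) where
  carrier := {p | p ∈ h.graph ∧ p.snd ∈ D'}
  add_mem' := fun ha hb => ⟨add_mem ha.1 hb.1, D'.add_mem ha.2 hb.2⟩
  zero_mem' := ⟨zero_mem _, D'.zero_mem⟩
  smul_mem' := fun c _ ha => ⟨h.graph.smul_mem c ha.1, D'.smul_mem c ha.2⟩

lemma ext_inner_dense (h : IsNormalPair D D' N N') {u v : E}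
    (huv : ∀ x ∈ D, inner ℂ u x = inner ℂ v x) : u = v :=
  h.dense.eq_of_inner_left (𝕜 := ℂ) huv

/-- The quadratic polynomial `N² - 2 a N + b` for real `a`, `b`. -/
def quad (N : E → E) (a b : ℝ) (x : E) : E :=
  N (N x) - ((2 * a : ℝ) : ℂ) • N x + (b : ℂ) • x

lemma quad_sub (h : IsNormalPair D D' N N') (a b : ℝ) {x y : E} (hx : x ∈ D) (hNx : N x ∈ D)
    (hy : y ∈ D) (hNy : N y ∈ D) : quad N a b (x - y) = quad N a b x - quad N a b y := by
  simp only [quad, h.map_sub hx hy, h.map_sub hNx hNy, smul_sub]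
  abel

/-- `l` is a regular point when `(N - l) (N - conj l)` is injective with dense range and bounded
inverse. -/
def IsRegularPoint (D : Submodule ℂ E) (N : E → E) (l : ℂ) : Prop :=
  (∀ x ∈ D, N x ∈ D → quad N l.re (Complex.normSq l) x = 0 → x = 0) ∧
  Dense (quad N l.re (Complex.normSq l) '' {x | x ∈ D ∧ N x ∈ D}) ∧
  ∃ M : ℝ, ∀ x ∈ D, N x ∈ D → ‖x‖ ≤ M * ‖quad N l.re (Complex.normSq l) x‖

lemma eq_zero_of_map_eq_smul (h : IsNormalPair D D' N N') {l : ℂ} (hl : IsRegularPoint D N l)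
    {x : E} (hx : x ∈ D) (hNx : N x = l • x) : x = 0 := by
  refine hl.1 x hx (hNx ▸ D.smul_mem l hx) ?_
  have hc : l * l - ((2 * l.re : ℝ) : ℂ) * l + (Complex.normSq l : ℂ) = 0 := by
    rw [← Complex.add_conj, ← Complex.mul_conj]; ring
  simp only [quad, hNx, h.map_smul l x hx, smul_smul, ← sub_smul, ← add_smul, hc, zero_smul]

variable [CompleteSpace E]

lemma exists_add_adjoint_comp (h : IsNormalPair D D' N N') (y : E) :
    ∃ z ∈ D, N z ∈ D' ∧ z + N' (N z) = y := by
  have hc : CompleteSpace h.graph := h.isClosed_graph.completeSpace_coe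
  set y0 : WithLp 2 (E × E) := WithLp.toLp 2 (y, 0) with hy0
  set g : WithLp 2 (E × E) := h.graph.starProjection y0 with hg
  have hgm : g ∈ h.graph := Submodule.starProjection_apply_mem _ _
  have horth : ∀ x ∈ D, inner ℂ (g.fst - y) x + inner ℂ g.snd (N x) = 0 := by
    intro x hx
    have h1 : y0 - g ∈ h.graphᗮ := Submodule.sub_starProjection_mem_orthogonal _
    have h2 := (Submodule.mem_orthogonal' _ _).1 h1 (WithLp.toLp 2 (x, N x)) ⟨hx, rfl⟩
    rw [WithLp.prod_inner_apply] at h2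
    have : inner ℂ (y - g.fst) x + inner ℂ (0 - g.snd) (N x) = 0 := h2
    simp only [inner_sub_left, inner_zero_left] at this ⊢
    linear_combination -this
  have hD : g.snd ∈ D' := by
    refine h.mem_adj _ ⟨‖g.fst - y‖, fun x hx => ?_⟩
    rw [eq_neg_of_add_eq_zero_right (horth x hx), norm_neg]
    exact norm_inner_le_norm _ _
  refine ⟨g.fst, hgm.1, hgm.2 ▸ hD, ?_⟩
  rw [← hgm.2]
  have : N' g.snd = y - g.fst := h.ext_inner_dense fun x hx => by
    rw [← h.adj _ hD x hx]
    have := horth x hx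
    simp only [inner_sub_left] at this ⊢
    linear_combination this
  rw [this]; abel

lemma graph_le_closure_core (h : IsNormalPair D D' N N') :
    h.graph ≤ h.core.topologicalClosure := by
  intro p hp
  set q := h.core.topologicalClosure.starProjection p with hq
  have hqm : q ∈ h.core.topologicalClosure := Submodule.starProjection_apply_mem _ _
  have hle : h.core.topologicalClosure ≤ h.graph :=
    Submodule.topologicalClosure_minimal _ (fun _ hx => hx.1) h.isClosed_graph
  have hpq : p - q ∈ h.graph := sub_mem hp (hle hqm)
  have horth : p - q ∈ (h.core.topologicalClosure)ᗮ :=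
    Submodule.sub_starProjection_mem_orthogonal _
  obtain ⟨z, hz, hNz, hzy⟩ := h.exists_add_adjoint_comp (p - q).fst
  have h1 := (Submodule.mem_orthogonal' _ _).1 horth (WithLp.toLp 2 (z, N z))
    (h.core.le_topologicalClosure ⟨⟨hz, rfl⟩, hNz⟩)
  rw [WithLp.prod_inner_apply] at h1
  have h2 : inner ℂ (p - q).fst z + inner ℂ (p - q).snd (N z) = 0 := h1
  have h3 : inner ℂ (N z) (N (p - q).fst) = inner ℂ (N' (N z)) (p - q).fst :=
    h.adj _ hNz _ hpq.1
  rw [hpq.2, ← inner_conj_symm, ← inner_conj_symm (N _), ← _root_.map_add, h3, ← inner_add_left, hzy]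
    at h2
  have h4 : (p - q).fst = 0 := by simpa using h2
  have h5 : (p - q).snd = 0 := by rw [hpq.2, h4, h.map_zero]
  have : p - q = 0 := by
    apply (WithLp.equiv 2 (E × E)).injective
    exact Prod.ext h4 h5
  rw [sub_eq_zero.1 this]
  exact hqm

lemma norm_inner_map_le (h : IsNormalPair D D' N N') {x u : E} (hx : x ∈ D) (hu : u ∈ D) :
    ‖inner ℂ x (N u)‖ ≤ ‖N x‖ * ‖u‖ := by
  have hcl : IsClosed {p : WithLp 2 (E × E) | ‖inner ℂ p.fst (N u)‖ ≤ ‖p.snd‖ * ‖u‖} :=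
    isClosed_le (by fun_prop) (by fun_prop)
  have hsub : (h.core : Set (WithLp 2 (E × E))) ⊆
      {p : WithLp 2 (E × E) | ‖inner ℂ p.fst (N u)‖ ≤ ‖p.snd‖ * ‖u‖} := by
    rintro p ⟨⟨hp1, hp2⟩, hp3⟩
    rw [hp2] at hp3
    obtain ⟨h1, h2⟩ := (h.comm_dom p.fst).1 ⟨hp1, hp3⟩
    have h3 : ‖N' p.fst‖ = ‖N p.fst‖ := by
      have : (inner ℂ (N' p.fst) (N' p.fst) : ℂ) = inner ℂ (N p.fst) (N p.fst) := by
        rw [← h.adj _ h1 _ h2, ← h.comm _ hp1 hp3, ← inner_conj_symm, ← h.adj _ hp3 _ hp1,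
          inner_conj_symm]
      rw [inner_self_eq_norm_sq_to_K, inner_self_eq_norm_sq_to_K] at this
      have h4 : ‖N' p.fst‖ ^ 2 = ‖N p.fst‖ ^ 2 := by exact_mod_cast this
      exact (sq_eq_sq₀ (norm_nonneg _) (norm_nonneg _)).1 h4
    change ‖inner ℂ p.fst (N u)‖ ≤ ‖p.snd‖ * ‖u‖
    rw [h.adj _ h1 _ hu, hp2, ← h3]
    exact norm_inner_le_norm _ _
  have := closure_minimal hsub hcl
  exact this (h.graph_le_closure_core (x := WithLp.toLp 2 (x, N x)) ⟨hx, rfl⟩)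

lemma dom_le_adj (h : IsNormalPair D D' N N') {x : E} (hx : x ∈ D) : x ∈ D' :=
  h.mem_adj x ⟨‖N x‖, fun _ hu => h.norm_inner_map_le hx hu⟩

lemma norm_adj_le (h : IsNormalPair D D' N N') {x : E} (hx : x ∈ D) : ‖N' x‖ ≤ ‖N x‖ := by
  have hcl : IsClosed {u : E | ‖inner ℂ (N' x) u‖ ≤ ‖N x‖ * ‖u‖} :=
    isClosed_le (by fun_prop) (by fun_prop)
  have hsub : (D : Set E) ⊆ {u : E | ‖inner ℂ (N' x) u‖ ≤ ‖N x‖ * ‖u‖} := fun u hu => by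
    change ‖inner ℂ (N' x) u‖ ≤ ‖N x‖ * ‖u‖
    rw [← h.adj x (h.dom_le_adj hx) u hu]
    exact h.norm_inner_map_le hx hu
  have h1 : ‖inner ℂ (N' x) (N' x)‖ ≤ ‖N x‖ * ‖N' x‖ :=
    closure_minimal hsub hcl (h.dense (N' x))
  rw [inner_self_eq_norm_sq_to_K] at h1
  have h2 : ‖N' x‖ ^ 2 ≤ ‖N x‖ * ‖N' x‖ := by simpa using h1
  rcases (norm_nonneg (N' x)).eq_or_lt with h0 | h0
  · rw [← h0]; exact norm_nonneg _
  · nlinarith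

lemma norm_sq_map_le (h : IsNormalPair D D' N N') {x : E} (hx : x ∈ D) (hNx : N x ∈ D) :
    ‖N x‖ ^ 2 ≤ ‖N (N x)‖ * ‖x‖ := by
  have h1 : (inner ℂ (N x) (N x) : ℂ) = inner ℂ (N' (N x)) x := h.adj _ (h.dom_le_adj hNx) _ hx
  rw [inner_self_eq_norm_sq_to_K] at h1
  have h2 : ‖N x‖ ^ 2 = ‖(inner ℂ (N' (N x)) x : ℂ)‖ := by rw [← h1]; simp
  rw [h2]
  exact (norm_inner_le_norm _ _).trans
    (mul_le_mul_of_nonneg_right (h.norm_adj_le hNx) (norm_nonneg _))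

lemma norm_map_le_quad (h : IsNormalPair D D' N N') (a b : ℝ) {x : E} (hx : x ∈ D)
    (hNx : N x ∈ D) :
    ‖N x‖ ≤ (1 + |b| + 3 * |a|) * (‖quad N a b x‖ + ‖x‖) := by
  have h1 := h.norm_sq_map_le hx hNx
  have h2 : ‖N (N x)‖ ≤ ‖quad N a b x‖ + 2 * |a| * ‖N x‖ + |b| * ‖x‖ := by
    have : N (N x) = quad N a b x + ((2 * a : ℝ) : ℂ) • N x - (b : ℂ) • x := by
      simp only [quad]; abel
    calc ‖N (N x)‖ = ‖quad N a b x + ((2 * a : ℝ) : ℂ) • N x - (b : ℂ) • x‖ := by rw [← this]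
      _ ≤ ‖quad N a b x‖ + ‖((2 * a : ℝ) : ℂ) • N x‖ + ‖(b : ℂ) • x‖ :=
        (norm_sub_le _ _).trans (add_le_add_left (norm_add_le _ _) _)
      _ = _ := by simp only [norm_smul, Complex.norm_real, Real.norm_eq_abs, abs_mul]; norm_num
  set t := ‖N x‖
  set s := ‖x‖
  set d := ‖quad N a b x‖
  have ht : 0 ≤ t := norm_nonneg _
  have hs : 0 ≤ s := norm_nonneg _
  have hd : 0 ≤ d := norm_nonneg _
  have ha := abs_nonneg a
  have hb := abs_nonneg b
  have h3 : t ^ 2 ≤ (d + 2 * |a| * t + |b| * s) * s :=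
    h1.trans (mul_le_mul_of_nonneg_right h2 hs)
  have h4 : (t - |a| * s) ^ 2 ≤ ((1 + |b| + |a|) * (d + s)) ^ 2 := by
    have e1 : d * s ≤ (d + s) ^ 2 := by nlinarith
    have e2 : s ^ 2 ≤ (d + s) ^ 2 := by nlinarith
    have e3 : (t - |a| * s) ^ 2 ≤ d * s + |b| * s ^ 2 + |a| ^ 2 * s ^ 2 := by nlinarith
    have e4 : |b| * s ^ 2 ≤ |b| * (d + s) ^ 2 := by gcongr
    have e5 : |a| ^ 2 * s ^ 2 ≤ |a| ^ 2 * (d + s) ^ 2 := by gcongr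
    have e6 : 1 + |b| + |a| ^ 2 ≤ (1 + |b| + |a|) ^ 2 := by nlinarith [mul_nonneg ha hb]
    have e7 : (1 + |b| + |a| ^ 2) * (d + s) ^ 2 ≤ (1 + |b| + |a|) ^ 2 * (d + s) ^ 2 := by
      gcongr
    rw [mul_pow]
    linarith
  have h5 := abs_le_of_sq_le_sq' h4 (by positivity)
  have h6 := h5.2
  have : |a| * s ≤ |a| * (d + s) := by gcongr; linarith
  nlinarith [mul_nonneg ha (add_nonneg hd hs)]

/-- If the quadratic polynomial of `N` has dense range and is bounded below, it is onto. -/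
lemma exists_quad_eq (h : IsNormalPair D D' N N') (a b : ℝ)
    (hdense : Dense (quad N a b '' {x | x ∈ D ∧ N x ∈ D}))
    (hM : ∃ M : ℝ, ∀ x ∈ D, N x ∈ D → ‖x‖ ≤ M * ‖quad N a b x‖) (y : E) :
    ∃ x ∈ D, N x ∈ D ∧ quad N a b x = y := by
  obtain ⟨M, hM⟩ := hM
  obtain ⟨w, hw, hwy⟩ := mem_closure_iff_seq_limit.1 (hdense y)
  choose x hx hxw using hw
  have hquad : CauchySeq (fun n => quad N a b (x n)) := by
    simp only [hxw]; exact hwy.cauchySeq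
  have key : ∀ (f : ℕ → E) (C : ℝ),
      (∀ n k, ‖f n - f k‖ ≤ C * ‖quad N a b (x n) - quad N a b (x k)‖) → CauchySeq f := by
    intro f C hC
    rw [Metric.cauchySeq_iff] at hquad ⊢
    intro ε hε
    obtain ⟨n0, hn0⟩ := hquad (ε / (|C| + 1)) (by positivity)
    refine ⟨n0, fun n hn k hk => ?_⟩
    have h1 := hn0 n hn k hk
    rw [dist_eq_norm, lt_div_iff₀ (by positivity)] at h1
    rw [dist_eq_norm]
    have h2 := hC n k
    have h3 := mul_le_mul_of_nonneg_right (le_abs_self C)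
      (norm_nonneg (quad N a b (x n) - quad N a b (x k)))
    have h4 := norm_nonneg (quad N a b (x n) - quad N a b (x k))
    nlinarith
  have hxM : ∀ n k, ‖x n - x k‖ ≤ M * ‖quad N a b (x n) - quad N a b (x k)‖ := fun n k => by
    rw [← h.quad_sub a b (hx n).1 (hx n).2 (hx k).1 (hx k).2]
    refine hM _ (D.sub_mem (hx n).1 (hx k).1) ?_
    rw [h.map_sub (hx n).1 (hx k).1]
    exact D.sub_mem (hx n).2 (hx k).2
  obtain ⟨ξ, hξ⟩ := cauchySeq_tendsto_of_complete (key x M hxM)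
  have hNx : ∀ n k, ‖N (x n) - N (x k)‖ ≤
      ((1 + |b| + 3 * |a|) * (1 + M)) * ‖quad N a b (x n) - quad N a b (x k)‖ := fun n k => by
    have h1 := h.norm_map_le_quad a b (D.sub_mem (hx n).1 (hx k).1)
      (by rw [h.map_sub (hx n).1 (hx k).1]; exact D.sub_mem (hx n).2 (hx k).2)
    rw [h.quad_sub a b (hx n).1 (hx n).2 (hx k).1 (hx k).2, h.map_sub (hx n).1 (hx k).1] at h1
    refine h1.trans ?_
    rw [mul_assoc]
    gcongr
    linarith [hxM n k]
  obtain ⟨η, hη⟩ := cauchySeq_tendsto_of_complete (key (fun n => N (x n)) _ hNx)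
  have h1 : ξ ∈ D ∧ η = N ξ :=
    h.closed.mem_of_tendsto (hξ.prodMk_nhds hη) (.of_forall fun n => ⟨(hx n).1, rfl⟩)
  have hq : Tendsto (fun n => quad N a b (x n)) atTop (𝓝 y) := by simpa only [hxw] using hwy
  have hNN : Tendsto (fun n => N (N (x n))) atTop
      (𝓝 (y + ((2 * a : ℝ) : ℂ) • η - (b : ℂ) • ξ)) := by
    have : (fun n => N (N (x n))) =
        fun n => quad N a b (x n) + ((2 * a : ℝ) : ℂ) • N (x n) - (b : ℂ) • x n := by
      funext n; simp only [quad]; abel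
    rw [this]
    exact (hq.add (hη.const_smul _)).sub (hξ.const_smul _)
  have h2 : η ∈ D ∧ _ = N η :=
    h.closed.mem_of_tendsto (hη.prodMk_nhds hNN) (.of_forall fun n => ⟨(hx n).2, rfl⟩)
  refine ⟨ξ, h1.1, h1.2 ▸ h2.1, ?_⟩
  simp only [quad]
  rw [← h1.2, ← h2.2]
  simp only
  module

lemma exists_map_sub_smul_eq (h : IsNormalPair D D' N N') {l : ℂ} (hl : IsRegularPoint D N l)
    (y : E) : ∃ x ∈ D, N x - l • x = y := by
  obtain ⟨x, hx, hNx, hxy⟩ := h.exists_quad_eq _ _ hl.2.1 hl.2.2 y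
  have hx' := D.smul_mem (starRingEnd ℂ l) hx
  refine ⟨N x - starRingEnd ℂ l • x, D.sub_mem hNx hx', ?_⟩
  rw [h.map_sub hNx hx', h.map_smul _ x hx, ← hxy, quad, ← Complex.add_conj, ← Complex.mul_conj]
  module

/-- The resolvent of `N` at a regular point. -/
lemma exists_resolvent (h : IsNormalPair D D' N N') {l : ℂ} (hl : IsRegularPoint D N l) :
    ∃ R : E →L[ℂ] E, (∀ y, R y ∈ D ∧ N (R y) - l • R y = y) ∧ ∀ x ∈ D, R (N x - l • x) = x := by
  choose R hRD hR using h.exists_map_sub_smul_eq hl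
  have huniq : ∀ x ∈ D, ∀ y, N x - l • x = y → R y = x := by
    intro x hx y hxy
    have := h.eq_zero_of_map_eq_smul hl (D.sub_mem (hRD y) hx) (by
      rw [h.map_sub (hRD y) hx, smul_sub]
      rw [sub_eq_sub_iff_sub_eq_sub, hR, hxy])
    exact sub_eq_zero.1 this
  let R' : E →ₗ[ℂ] E :=
    { toFun := R
      map_add' := fun y z => huniq _ (D.add_mem (hRD y) (hRD z)) _ (by
        rw [h.map_add _ (hRD y) _ (hRD z), smul_add, add_sub_add_comm, hR, hR])
      map_smul' := fun c y => huniq _ (D.smul_mem c (hRD y)) _ (by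
        rw [h.map_smul c _ (hRD y), smul_comm l, ← smul_sub, hR]) }
  have hcl : IsClosed (R'.graph : Set (E × E)) := by
    have : (R'.graph : Set (E × E)) =
        (fun p : E × E => (p.2, p.1 + l • p.2)) ⁻¹' {p : E × E | p.1 ∈ D ∧ p.2 = N p.1} := by
      ext p
      simp only [SetLike.mem_coe, LinearMap.mem_graph_iff, Set.mem_preimage, Set.mem_ofPred_eq]
      constructor
      · intro hp
        rw [hp]
        exact ⟨hRD _, (sub_eq_iff_eq_add.1 (hR p.1)).symm⟩
      · rintro ⟨h1, h2⟩
        exact (huniq _ h1 _ (by rw [← h2]; abel)).symm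
    rw [this]
    exact h.closed.preimage (by fun_prop)
  exact ⟨ContinuousLinearMap.ofIsClosedGraph hcl, fun y => ⟨hRD y, hR y⟩,
    fun x hx => huniq x hx _ rfl⟩

open ContinuousLinearMap in
lemma isStarNormal_resolvent (h : IsNormalPair D D' N N') {l : ℂ} {R : E →L[ℂ] E}
    (hR : ∀ y, R y ∈ D ∧ N (R y) - l • R y = y) (hR' : ∀ x ∈ D, R (N x - l • x) = x) :
    IsStarNormal R := by
  have hNR : ∀ y, N (R y) = y + l • R y := fun y => by rw [← sub_eq_iff_eq_add, (hR y).2]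
  have hadj : ∀ y, ∀ x ∈ D,
      inner ℂ (adjoint R y) (N x) = inner ℂ (y + starRingEnd ℂ l • adjoint R y) x := by
    intro y x hx
    have h1 : R (N x) = x + l • R x := by
      have := hR' x hx
      rw [_root_.map_sub, _root_.map_smul] at this
      rw [← sub_eq_iff_eq_add, this]
    rw [adjoint_inner_left, h1, inner_add_right, inner_add_left, inner_smul_right, inner_smul_left,
      adjoint_inner_left, Complex.conj_conj]
  have hmem : ∀ y, adjoint R y ∈ D' := fun y =>
    h.mem_adj _ ⟨‖y + starRingEnd ℂ l • adjoint R y‖, fun x hx => by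
      rw [hadj y x hx]; exact norm_inner_le_norm _ _⟩
  have hN' : ∀ y, N' (adjoint R y) = y + starRingEnd ℂ l • adjoint R y := fun y =>
    h.ext_inner_dense fun x hx => by rw [← h.adj _ (hmem y) x hx, hadj y x hx]
  have hRN' : ∀ x ∈ D', adjoint R (N' x - starRingEnd ℂ l • x) = x := fun x hx => by
    refine ext_inner_right ℂ fun z => ?_
    rw [adjoint_inner_left, inner_sub_left, ← h.adj x hx _ (hR z).1, hNR, inner_add_right,
      inner_smul_right, inner_smul_left, Complex.conj_conj]
    ring
  have hN'D : ∀ x ∈ D, N x ∈ D' → N' (N x - l • x) = N' (N x) - l • N' x := by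
    intro x hx hNx
    have hx' := h.dom_le_adj hx
    refine h.ext_inner_dense fun u hu => ?_
    rw [← h.adj _ (D'.sub_mem hNx (D'.smul_mem l hx')) u hu, inner_sub_left, inner_sub_left,
      inner_smul_left, inner_smul_left, h.adj _ hNx u hu, h.adj _ hx' u hu]
  refine ⟨?_⟩
  rw [star_eq_adjoint]
  change adjoint R * R = R * adjoint R
  ext y
  change adjoint R (R y) = R (adjoint R y)
  set x := R (adjoint R y) with hx
  have hxD : x ∈ D := (hR _).1
  have hx' := h.dom_le_adj hxD
  have hNx : N x = adjoint R y + l • x := hNR _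
  have hNxD' : N x ∈ D' := hNx ▸ D'.add_mem (hmem y) (D'.smul_mem l hx')
  obtain ⟨-, hN'x⟩ := (h.comm_dom x).1 ⟨hxD, hNxD'⟩
  have hy : y = N (N' x - starRingEnd ℂ l • x) - l • (N' x - starRingEnd ℂ l • x) := by
    rw [h.map_sub hN'x (D.smul_mem _ hxD), h.map_smul _ x hxD, ← h.comm x hxD hNxD']
    have h1 : N' (N x - l • x) = y + starRingEnd ℂ l • (N x - l • x) := by
      have : N x - l • x = adjoint R y := by rw [hNx]; abel
      rw [this, hN']
    rw [hN'D x hxD hNxD', ← sub_eq_iff_eq_add] at h1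
    rw [← h1]
    module
  have hRy : R y = N' x - starRingEnd ℂ l • x := by
    conv_lhs => rw [hy]
    exact hR' _ (D.sub_mem hN'x (D.smul_mem _ hxD))
  rw [hRy, hRN' x hx']

/-- The indicator of an isolated spectral value `0` yields a kernel vector. -/
lemma _root_.isUnit_of_injective_of_isolated (R : E →L[ℂ] E) [IsStarNormal R]
    (hinj : Function.Injective R) {c : ℝ} (hc : 0 < c)
    (hspec : ∀ z ∈ spectrum ℂ R, z ≠ 0 → c ≤ ‖z‖) : IsUnit R := by
  by_contra hR
  have h0 : (0 : ℂ) ∈ spectrum ℂ R := spectrum.zero_mem_iff ℂ |>.2 hR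
  let f : ℂ → ℂ := fun z => ((max 0 (1 - ‖z‖ / c) : ℝ) : ℂ)
  have hf : Continuous f := by fun_prop
  have h1 : R * cfc f R = 0 := by
    nth_rewrite 1 [← cfc_id' ℂ R]
    rw [← cfc_mul (fun z => z) f R continuousOn_id hf.continuousOn, ← cfc_zero ℂ R]
    refine cfc_congr fun z hz => ?_
    rcases eq_or_ne z 0 with rfl | hz0
    · simp
    · have : 1 - ‖z‖ / c ≤ 0 := by
        rw [sub_nonpos, one_le_div hc]
        exact hspec z hz hz0
      simp [f, max_eq_left this]
  have h2 : cfc f R = 0 := by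
    ext y
    apply hinj
    have := congrArg (fun S : E →L[ℂ] E => S y) h1
    simpa using this
  have h3 := eqOn_of_cfc_eq_cfc (f := f) (g := fun _ => 0) (a := R) (by simpa using h2)
    hf.continuousOn continuousOn_const
  have h4 := h3 h0
  simp [f] at h4

lemma dom_eq_top (h : IsNormalPair D D' N N') {r : ℝ}
    (hreg : ∀ l : ℂ, r < ‖l‖ → IsRegularPoint D N l) (x : E) : x ∈ D := by
  set l : ℂ := ((|r| + 1 : ℝ) : ℂ) with hl
  have hln : ‖l‖ = |r| + 1 := by
    rw [hl, Complex.norm_real, Real.norm_eq_abs, abs_of_pos (by positivity)]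
  have hrl : r < ‖l‖ := by rw [hln]; linarith [le_abs_self r]
  obtain ⟨R, hR, hR'⟩ := h.exists_resolvent (hreg l hrl)
  have := h.isStarNormal_resolvent hR hR'
  have hinj : Function.Injective R := by
    refine (injective_iff_map_eq_zero R).2 fun y hy => ?_
    rw [← (hR y).2, hy, h.map_zero]
    simp
  have hsurj : Function.Surjective R := by
    have hunit : IsUnit R := by
      refine isUnit_of_injective_of_isolated R hinj (c := (|r| + ‖l‖ + 1)⁻¹)
        (by positivity) fun z hz hz0 => ?_
      have hle : ‖l + z⁻¹‖ ≤ r := by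
        by_contra! hlt
        have hlz := hreg _ hlt
        refine hz ?_
        change IsUnit (algebraMap ℂ (E →L[ℂ] E) z - R)
        rw [ContinuousLinearMap.isUnit_iff_bijective]
        have key : ∀ y, (algebraMap ℂ (E →L[ℂ] E) z - R) y =
            z • (N (R y) - (l + z⁻¹) • R y) := fun y => by
          have : (algebraMap ℂ (E →L[ℂ] E) z - R) y = z • y - R y := by
            simp [Algebra.algebraMap_eq_smul_one]
          rw [this]
          rw [add_smul, ← sub_sub, smul_sub z _ (z⁻¹ • _), smul_inv_smul₀ hz0, (hR y).2]
        constructor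
        · refine (injective_iff_map_eq_zero _).2 fun y hy => ?_
          rw [key, smul_eq_zero_iff_right hz0, sub_eq_zero] at hy
          exact hinj ((h.eq_zero_of_map_eq_smul hlz (hR y).1 hy).trans (_root_.map_zero R).symm)
        · intro w
          obtain ⟨u, hu, huw⟩ := h.exists_map_sub_smul_eq hlz (z⁻¹ • w)
          refine ⟨N u - l • u, ?_⟩
          rw [key, hR' u hu, huw, smul_inv_smul₀ hz0]
      have : ‖z⁻¹‖ ≤ |r| + ‖l‖ + 1 := by
        have := norm_sub_le (l + z⁻¹) l
        rw [add_sub_cancel_left] at this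
        linarith [le_abs_self r]
      rw [norm_inv] at this
      exact inv_le_of_inv_le₀ (norm_pos_iff.2 hz0) this
    exact (ContinuousLinearMap.isUnit_iff_bijective.1 hunit).2
  obtain ⟨y, rfl⟩ := hsurj x
  exact (hR y).1

/-- A normal operator all of whose points near infinity are regular is bounded, and its
spectrum avoids the regular points. -/
theorem exists_bounded (h : IsNormalPair D D' N N') {r : ℝ}
    (hreg : ∀ l : ℂ, r < ‖l‖ → IsRegularPoint D N l) :
    D = ⊤ ∧ ∃ T : E →L[ℂ] E, IsStarNormal T ∧ (∀ x, T x = N x) ∧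
      ∀ l ∈ spectrum ℂ T, ¬ IsRegularPoint D N l := by
  have hD : ∀ x, x ∈ D := h.dom_eq_top hreg
  have hD' : ∀ x, x ∈ D' := fun x => h.dom_le_adj (hD x)
  let T' : E →ₗ[ℂ] E :=
    { toFun := N
      map_add' := fun x y => h.map_add x (hD x) y (hD y)
      map_smul' := fun c x => h.map_smul c x (hD x) }
  have hcl : IsClosed (T'.graph : Set (E × E)) := by
    convert h.closed using 1
    ext p
    simp [LinearMap.mem_graph_iff, hD, T']
  let T : E →L[ℂ] E := ContinuousLinearMap.ofIsClosedGraph hcl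
  have hT : ∀ x, T x = N x := fun _ => rfl
  have hTadj : ∀ x, ContinuousLinearMap.adjoint T x = N' x := fun x =>
    ext_inner_right ℂ fun z => by
      rw [ContinuousLinearMap.adjoint_inner_left, hT, h.adj x (hD' x) z (hD z)]
  refine ⟨Submodule.eq_top_iff'.2 hD, T, ⟨?_⟩, hT, fun l hl hreg => hl ?_⟩
  · rw [ContinuousLinearMap.star_eq_adjoint]
    ext x
    change ContinuousLinearMap.adjoint T (T x) = T (ContinuousLinearMap.adjoint T x)
    rw [hTadj, hTadj, hT, hT, h.comm x (hD x) (hD' _)]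
  · change IsUnit (algebraMap ℂ (E →L[ℂ] E) l - T)
    have key : ∀ y, (algebraMap ℂ (E →L[ℂ] E) l - T) y = -(N y - l • y) := fun y => by
      simp [Algebra.algebraMap_eq_smul_one, hT]
    rw [ContinuousLinearMap.isUnit_iff_bijective]
    constructor
    · refine (injective_iff_map_eq_zero _).2 fun y hy => ?_
      rw [key, neg_eq_zero, sub_eq_zero] at hy
      exact h.eq_zero_of_map_eq_smul hreg (hD y) hy
    · intro w
      obtain ⟨u, hu, huw⟩ := h.exists_map_sub_smul_eq hreg (-w)
      exact ⟨u, by rw [key, huw, neg_neg]⟩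

end IsNormalPair

/-- A quaternionic structure on a complex Hilbert space: a conjugate linear isometry of
square `-1`. -/
structure IsQuatStructure {E : Type*} [NormedAddCommGroup E] [InnerProductSpace ℂ E]
    (J : E → E) : Prop where
  map_add : ∀ x y, J (x + y) = J x + J y
  map_smul : ∀ (c : ℂ) x, J (c • x) = starRingEnd ℂ c • J x
  inner_map : ∀ x y, inner ℂ (J x) (J y) = inner ℂ y x
  sq : ∀ x, J (J x) = -x

namespace IsQuatStructure

variable {E : Type*} [NormedAddCommGroup E] [InnerProductSpace ℂ E] {J : E → E}

lemma map_zero (hJ : IsQuatStructure J) : J 0 = 0 := by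
  simpa using hJ.map_smul 0 0

lemma map_neg (hJ : IsQuatStructure J) (x : E) : J (-x) = -J x := by
  simpa using hJ.map_smul (-1) x

lemma map_sub (hJ : IsQuatStructure J) (x y : E) : J (x - y) = J x - J y := by
  rw [sub_eq_add_neg, hJ.map_add, hJ.map_neg, sub_eq_add_neg]

lemma norm_map (hJ : IsQuatStructure J) (x : E) : ‖J x‖ = ‖x‖ := by
  rw [@norm_eq_sqrt_re_inner ℂ, @norm_eq_sqrt_re_inner ℂ, hJ.inner_map]

lemma isometry (hJ : IsQuatStructure J) : Isometry J :=
  Isometry.of_dist_eq fun x y => by rw [dist_eq_norm, dist_eq_norm, ← hJ.map_sub, hJ.norm_map]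

lemma continuous (hJ : IsQuatStructure J) : Continuous J := hJ.isometry.continuous

lemma inner_left (hJ : IsQuatStructure J) (x y : E) :
    inner ℂ (J x) y = - inner ℂ (J y) x := by
  have := hJ.inner_map x (J y)
  rw [hJ.sq, inner_neg_right] at this
  rw [← this, neg_neg]

lemma inner_right (hJ : IsQuatStructure J) (x y : E) :
    inner ℂ x (J y) = - inner ℂ y (J x) := by
  have := hJ.inner_map (J x) y
  rw [hJ.sq, inner_neg_left] at this
  rw [← this, neg_neg]

/-- A vector is orthogonal to its image under the quaternionic structure. -/
lemma inner_self_map (hJ : IsQuatStructure J) (x : E) : inner ℂ x (J x) = 0 :=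
  self_eq_neg.1 (hJ.inner_right x x)

lemma starProjection_map (hJ : IsQuatStructure J) {U V : Submodule ℂ E}
    [U.HasOrthogonalProjection] [V.HasOrthogonalProjection] (hUV : ∀ x ∈ U, J x ∈ V)
    (hVU : ∀ x ∈ V, J x ∈ U) (x : E) : V.starProjection (J x) = J (U.starProjection x) := by
  refine Submodule.eq_starProjection_of_mem_of_inner_eq_zero
    (hUV _ (U.starProjection_apply_mem x)) fun w hw => ?_
  rw [← hJ.map_sub, hJ.inner_left, ← inner_conj_symm,
    U.starProjection_inner_eq_zero x _ (hVU w hw)]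
  simp

end IsQuatStructure

section Functional

variable {E : Type*} [NormedAddCommGroup E] [InnerProductSpace ℂ E] [CompleteSpace E]

open ContinuousLinearMap in
lemma Submodule.starProjection_comm_of_invariant {U : Submodule ℂ E} [U.HasOrthogonalProjection]
    {S : E →L[ℂ] E} (h1 : ∀ x ∈ U, S x ∈ U) (h2 : ∀ x ∈ U, adjoint S x ∈ U) (x : E) :
    U.starProjection (S x) = S (U.starProjection x) := by
  refine eq_starProjection_of_mem_of_inner_eq_zero
    (h1 _ (U.starProjection_apply_mem x)) fun w hw => ?_
  rw [← _root_.map_sub, ← adjoint_inner_right, U.starProjection_inner_eq_zero x _ (h2 w hw)]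

variable {K : Set ℂ} (Ψ : C(K, ℂ) →⋆ₐ[ℂ] (E →L[ℂ] E))

/-- The spectral subspace of a functional calculus attached to a set `F`. -/
def spectralSubspace (F : Set K) : Submodule ℂ E where
  carrier := {x | ∀ f : C(K, ℂ), (∀ z ∈ F, f z = 0) → Ψ f x = 0}
  add_mem' := fun ha hb f hf => by rw [_root_.map_add, ha f hf, hb f hf, add_zero]
  zero_mem' := fun f _ => _root_.map_zero _
  smul_mem' := fun c x hx f hf => by rw [_root_.map_smul, hx f hf, smul_zero]

lemma mem_spectralSubspace {F : Set K} {x : E} :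
    x ∈ spectralSubspace Ψ F ↔ ∀ f : C(K, ℂ), (∀ z ∈ F, f z = 0) → Ψ f x = 0 := Iff.rfl

instance (F : Set K) : CompleteSpace (spectralSubspace Ψ F) := by
  have : IsClosed (spectralSubspace Ψ F : Set E) := by
    have : (spectralSubspace Ψ F : Set E) =
        ⋂ (f : C(K, ℂ)) (_ : ∀ z ∈ F, f z = 0), {x | Ψ f x = 0} := by
      ext x; simp [mem_spectralSubspace]
    rw [this]
    exact isClosed_iInter fun f => isClosed_iInter fun _ =>
      isClosed_eq (Ψ f).continuous continuous_const
  exact this.completeSpace_coe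

/-- The spectral projection of a functional calculus attached to a set `F`. -/
def spectralProj (F : Set K) : E →L[ℂ] E := (spectralSubspace Ψ F).starProjection

lemma isSelfAdjoint_spectralProj (F : Set K) : IsSelfAdjoint (spectralProj Ψ F) :=
  isSelfAdjoint_starProjection _

lemma spectralSubspace_mono {F G : Set K} (h : F ⊆ G) :
    spectralSubspace Ψ F ≤ spectralSubspace Ψ G :=
  fun _ hx f hf => hx f fun z hz => hf z (h hz)

lemma spectralSubspace_empty : spectralSubspace Ψ ∅ = ⊥ := by
  refine (Submodule.eq_bot_iff _).2 fun x hx => ?_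
  simpa using hx 1 (by simp)

lemma map_apply_mem_spectralSubspace {F : Set K} {x : E} {S : E →L[ℂ] E}
    (hS : ∀ f x, Ψ f (S x) = S (Ψ f x)) (hx : x ∈ spectralSubspace Ψ F) :
    S x ∈ spectralSubspace Ψ F :=
  fun f hf => by rw [hS, hx f hf, _root_.map_zero]

lemma calculus_comm (f g : C(K, ℂ)) (x : E) : Ψ f (Ψ g x) = Ψ g (Ψ f x) := by
  have h : Ψ f * Ψ g = Ψ g * Ψ f := by rw [← _root_.map_mul, mul_comm, _root_.map_mul]
  exact congrArg (fun S : E →L[ℂ] E => S x) h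

lemma adjoint_calculus (f : C(K, ℂ)) : ContinuousLinearMap.adjoint (Ψ f) = Ψ (star f) := by
  rw [map_star]; rfl

lemma inner_calculus_left (f : C(K, ℂ)) (x y : E) :
    inner ℂ (Ψ f x) y = inner ℂ x (Ψ (star f) y) := by
  rw [← adjoint_calculus, ContinuousLinearMap.adjoint_inner_right]

lemma spectralProj_calculus (F : Set K) (f : C(K, ℂ)) (x : E) :
    spectralProj Ψ F (Ψ f x) = Ψ f (spectralProj Ψ F x) := by
  refine Submodule.starProjection_comm_of_invariant
    (fun x hx => map_apply_mem_spectralSubspace Ψ (fun g x => calculus_comm Ψ g f x) hx)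
    (fun x hx => ?_) x
  rw [adjoint_calculus]
  exact map_apply_mem_spectralSubspace Ψ (fun g x => calculus_comm Ψ g _ x) hx

lemma spectralProj_comm (F G : Set K) (x : E) :
    spectralProj Ψ F (spectralProj Ψ G x) = spectralProj Ψ G (spectralProj Ψ F x) := by
  have h : ∀ x ∈ spectralSubspace Ψ F, spectralProj Ψ G x ∈ spectralSubspace Ψ F := fun x hx =>
    map_apply_mem_spectralSubspace Ψ (fun f x => (spectralProj_calculus Ψ G f x).symm) hx
  refine Submodule.starProjection_comm_of_invariant h (fun x hx => ?_) x
  rw [← ContinuousLinearMap.star_eq_adjoint, (isSelfAdjoint_spectralProj Ψ G).star_eq]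
  exact h x hx

/-- The calculus is estimated by the supremum norm on a difference of spectral subspaces. -/
lemma norm_calculus_sub_le {A B : Set K} {ψ : C(K, ℂ)} {l : ℂ} {d : ℝ} (hd : 0 ≤ d)
    (h : ∀ z ∈ B, z ∉ A → ‖ψ z - l‖ ≤ d) {x : E} (hB : x ∈ spectralSubspace Ψ B)
    (hA : x ∈ (spectralSubspace Ψ A)ᗮ) : ‖Ψ ψ x - l • x‖ ≤ d * ‖x‖ := by
  let u : K → ℝ := fun z => ‖ψ z - l‖ ^ 2 - d ^ 2
  have hu : Continuous u := by fun_prop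
  let p : C(K, ℂ) := ⟨fun z => ((max 0 (u z) : ℝ) : ℂ), by fun_prop⟩
  let w : C(K, ℂ) := ⟨fun z => ((Real.sqrt (max 0 (-u z)) : ℝ) : ℂ), by fun_prop⟩
  let q : C(K, ℂ) := ψ - algebraMap ℂ C(K, ℂ) l
  have hq : star q * q = p - star w * w + algebraMap ℂ C(K, ℂ) ((d ^ 2 : ℝ) : ℂ) := by
    ext z
    have h1 : star (ψ z - l) * (ψ z - l) = ((‖ψ z - l‖ ^ 2 : ℝ) : ℂ) := by
      rw [mul_comm]
      simpa using Complex.mul_conj' (ψ z - l)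
    have h2 : (Real.sqrt (max 0 (-u z))) * (Real.sqrt (max 0 (-u z))) = max 0 (-u z) :=
      Real.mul_self_sqrt (le_max_left _ _)
    have h3 : max 0 (u z) - max 0 (-u z) = u z := by
      rcases le_total 0 (u z) with h | h
      · rw [max_eq_right h, max_eq_left (by linarith)]; ring
      · rw [max_eq_left h, max_eq_right (by linarith)]; ring
    change star (ψ z - l) * (ψ z - l) = ((max 0 (u z) : ℝ) : ℂ) -
      star ((Real.sqrt (max 0 (-u z)) : ℝ) : ℂ) * ((Real.sqrt (max 0 (-u z)) : ℝ) : ℂ) +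
      ((d ^ 2 : ℝ) : ℂ)
    rw [h1]
    simp only [Complex.star_def, Complex.conj_ofReal]
    rw [← Complex.ofReal_mul, h2, ← Complex.ofReal_sub, h3, ← Complex.ofReal_add]
    simp [u]
  have hqx : Ψ q x = Ψ ψ x - l • x := by
    simp only [q, _root_.map_sub, AlgHomClass.commutes]
    simp [Algebra.algebraMap_eq_smul_one]
  have hp : inner ℂ x (Ψ p x) = 0 := by
    refine Submodule.inner_left_of_mem_orthogonal (K := spectralSubspace Ψ A) ?_ hA
    intro f hf
    have : Ψ (f * p) x = 0 := by
      refine hB _ fun z hz => ?_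
      by_cases hzA : z ∈ A
      · simp [hf z hzA]
      · have : u z ≤ 0 := by
          have := h z hz hzA
          simp only [u]
          nlinarith [norm_nonneg (ψ z - l)]
        simp [p, max_eq_left this]
    rwa [_root_.map_mul] at this
  have hw : inner ℂ x (Ψ (star w * w) x) = ((‖Ψ w x‖ ^ 2 : ℝ) : ℂ) := by
    rw [_root_.map_mul, mul_apply_eq_comp, ← inner_calculus_left,
      inner_self_eq_norm_sq_to_K]
    simp
  have hkey : ((‖Ψ q x‖ ^ 2 : ℝ) : ℂ) = ((d ^ 2 * ‖x‖ ^ 2 - ‖Ψ w x‖ ^ 2 : ℝ) : ℂ) := by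
    have h1 : inner ℂ x (Ψ (star q * q) x) = ((‖Ψ q x‖ ^ 2 : ℝ) : ℂ) := by
      rw [_root_.map_mul, mul_apply_eq_comp, ← inner_calculus_left,
        inner_self_eq_norm_sq_to_K]
      simp
    rw [← h1, hq, _root_.map_add, _root_.map_sub, AlgHomClass.commutes,
      add_apply, sub_apply, inner_add_right,
      inner_sub_right, hp, hw]
    simp [Algebra.algebraMap_eq_smul_one, inner_smul_right, inner_self_eq_norm_sq_to_K]
    ring
  have hkey' := Complex.ofReal_injective hkey
  rw [← hqx]
  refine le_of_sq_le_sq ?_ (by positivity)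
  rw [hkey', mul_pow]
  linarith [sq_nonneg ‖Ψ w x‖]

/-- The continuous functional calculus of a normal operator, defined on a compact set
containing the spectrum. -/
def extendedCalculus (T : E →L[ℂ] E) [hT : IsStarNormal T] (h : spectrum ℂ T ⊆ K) :
    C(K, ℂ) →⋆ₐ[ℂ] (E →L[ℂ] E) :=
  (cfcHom (R := ℂ) hT).comp
    (ContinuousMap.compStarAlgHom' ℂ ℂ ⟨Set.inclusion h, continuous_inclusion h⟩)

lemma extendedCalculus_id (T : E →L[ℂ] E) [hT : IsStarNormal T] (h : spectrum ℂ T ⊆ K) :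
    extendedCalculus T h (ContinuousMap.restrict K (ContinuousMap.id ℂ)) = T :=
  cfcHom_id hT

lemma continuous_extendedCalculus (T : E →L[ℂ] E) [hT : IsStarNormal T]
    (h : spectrum ℂ T ⊆ K) : Continuous (extendedCalculus T h) :=
  (cfcHom_continuous hT).comp (ContinuousMap.continuous_precomp _)

lemma extendedCalculus_eq_zero (T : E →L[ℂ] E) [hT : IsStarNormal T] (h : spectrum ℂ T ⊆ K)
    {f : C(K, ℂ)} (hf : ∀ z : K, (z : ℂ) ∈ spectrum ℂ T → f z = 0) :
    extendedCalculus T h f = 0 := by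
  have : f.comp ⟨Set.inclusion h, continuous_inclusion h⟩ = 0 := by
    ext z
    exact hf _ z.2
  change cfcHom (R := ℂ) hT (f.comp ⟨Set.inclusion h, continuous_inclusion h⟩) = 0
  rw [this, _root_.map_zero]

/-- The reflection `f ↦ (z ↦ conj (f (conj z)))`. -/
def conjReflect (hK : ∀ z ∈ K, starRingEnd ℂ z ∈ K) (f : C(K, ℂ)) : C(K, ℂ) :=
  ⟨fun z => starRingEnd ℂ (f ⟨starRingEnd ℂ z, hK z z.2⟩), by fun_prop⟩

lemma extendedCalculus_quat (T : E →L[ℂ] E) [hT : IsStarNormal T] (h : spectrum ℂ T ⊆ K)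
    [CompactSpace K] (hK : ∀ z ∈ K, starRingEnd ℂ z ∈ K) {J : E → E} (hJ : IsQuatStructure J)
    (hTJ : ∀ x, T (J x) = J (T x)) (f : C(K, ℂ)) :
    ∀ x, J (extendedCalculus T h f x) = extendedCalculus T h (conjReflect hK f) (J x) := by
  have hTJ' : ∀ x, J (ContinuousLinearMap.adjoint T x) = ContinuousLinearMap.adjoint T (J x) := by
    intro x
    refine ext_inner_right ℂ fun y => ?_
    rw [ContinuousLinearMap.adjoint_inner_left, hJ.inner_left,
      ContinuousLinearMap.adjoint_inner_right, hJ.inner_left, hTJ]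
  induction f using ContinuousMap.induction_on_of_compact with
  | const r =>
    intro x
    have h1 : ContinuousMap.const K r = algebraMap ℂ C(K, ℂ) r := rfl
    have h2 : conjReflect hK (algebraMap ℂ C(K, ℂ) r)
        = algebraMap ℂ C(K, ℂ) (starRingEnd ℂ r) := rfl
    rw [h1, h2, AlgHomClass.commutes, AlgHomClass.commutes]
    simp [Algebra.algebraMap_eq_smul_one, hJ.map_smul]
  | id =>
    intro x
    have : conjReflect hK (ContinuousMap.restrict K (ContinuousMap.id ℂ)) =
        ContinuousMap.restrict K (ContinuousMap.id ℂ) := by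
      ext z; simp [conjReflect]
    rw [this, extendedCalculus_id, hTJ]
  | star_id =>
    intro x
    have : conjReflect hK (star (ContinuousMap.restrict K (ContinuousMap.id ℂ))) =
        star (ContinuousMap.restrict K (ContinuousMap.id ℂ)) := by
      ext z; simp [conjReflect]
    rw [this, map_star, extendedCalculus_id, ContinuousLinearMap.star_eq_adjoint, hTJ']
  | add f g hf hg =>
    intro x
    have : conjReflect hK (f + g) = conjReflect hK f + conjReflect hK g := by
      ext z; simp [conjReflect]
    rw [this, _root_.map_add, _root_.map_add, add_apply, add_apply, hJ.map_add, hf, hg]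
  | mul f g hf hg =>
    intro x
    have : conjReflect hK (f * g) = conjReflect hK f * conjReflect hK g := by
      ext z; simp [conjReflect]
    rw [this, _root_.map_mul, _root_.map_mul, mul_apply_eq_comp, mul_apply_eq_comp, hf, hg]
  | frequently f hf =>
    intro x
    have hc : Continuous (conjReflect hK) := by
      have hc1 : Continuous fun f : C(K, ℂ) => star (f.comp
          (⟨fun z => ⟨starRingEnd ℂ z, hK z z.2⟩, by fun_prop⟩ : C(K, K))) :=
        continuous_star.comp (ContinuousMap.continuous_precomp _)
      exact hc1
    have hcl : IsClosed {f : C(K, ℂ) |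
        J (extendedCalculus T h f x) = extendedCalculus T h (conjReflect hK f) (J x)} := by
      refine isClosed_eq (hJ.continuous.comp ?_) ?_
      · exact (continuous_extendedCalculus T h).clm_apply continuous_const
      · exact ((continuous_extendedCalculus T h).comp hc).clm_apply continuous_const
    exact hcl.mem_of_frequently_of_tendsto (hf.mono fun g hg => hg x) tendsto_id

end Functional

/-- Spectral data for an operator `T` commuting with a quaternionic structure `J`: an increasing
family of projections `P a` commuting with `J`, and complementary half space projections `R`, `R'`
exchanged by `J`, such that `T` is nearly scalar on the range of `R (P b - P a)`. -/
structure IsSpectralSplitting {E : Type*} [NormedAddCommGroup E] [InnerProductSpace ℂ E]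
    (T : E →L[ℂ] E) (J : E → E) (C : ℝ) (P : ℝ → E →L[ℂ] E) (R R' : E →L[ℂ] E) : Prop where
  symm : ∀ a x y, inner ℂ (P a x) y = inner ℂ x (P a y)
  mul : ∀ a b x, P a (P b x) = P (min a b) x
  zero : ∀ x, P 0 x = 0
  one : ∀ x, P 1 x = x
  map_J : ∀ a x, P a (J x) = J (P a x)
  symm_half : ∀ x y, inner ℂ (R x) y = inner ℂ x (R y)
  idem_half : ∀ x, R (R x) = R x
  comm_half : ∀ a x, R (P a x) = P a (R x)
  map_half : ∀ x, R (J x) = J (R' x)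
  map_half' : ∀ x, R' (J x) = J (R x)
  comm_halves : ∀ x, R (R' x) = R' (R x)
  cover : ∀ x, R x + R' x - R (R' x) = x
  norm_sub_le : ∀ a b, a ≤ b → ∃ l : ℂ, ∀ x, R x = x → P b x - P a x = x →
    ‖T x - l • x‖ ≤ C * (b - a) * ‖x‖

/-- The reflection of the complex plane onto the closed upper half plane. -/
def upperFold (z : ℂ) : ℂ := ⟨z.re, |z.im|⟩

lemma continuous_upperFold : Continuous upperFold := by
  have : upperFold = fun z : ℂ => (z.re : ℂ) + ((|z.im| : ℝ) : ℂ) * Complex.I := by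
    ext1 z
    apply Complex.ext <;> simp [upperFold]
  rw [this]
  fun_prop

lemma upperFold_conj (z : ℂ) : upperFold (starRingEnd ℂ z) = upperFold z := by
  simp [upperFold]

section

variable {E : Type*} [NormedAddCommGroup E] [InnerProductSpace ℂ E] [CompleteSpace E]

lemma mem_spectralSubspace_of_inter {K : Set ℂ} (Ψ : C(K, ℂ) →⋆ₐ[ℂ] (E →L[ℂ] E)) {A B : Set K}
    (hAB : ∀ z, z ∈ A ∨ z ∈ B) {x : E} (hx : x ∈ (spectralSubspace Ψ A)ᗮ) :
    x ∈ spectralSubspace Ψ B := by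
  intro f hf
  refine ext_inner_right ℂ fun y => ?_
  rw [inner_calculus_left, inner_zero_left]
  refine Submodule.inner_left_of_mem_orthogonal (K := spectralSubspace Ψ A) ?_ hx
  intro k hk
  have : k * star f = 0 := by
    ext z
    rcases hAB z with hz | hz
    · simp [hk z hz]
    · simp [hf z hz]
  have h2 := congrArg (fun S : E →L[ℂ] E => S y) ((_root_.map_mul Ψ k (star f)).symm.trans
    (by rw [this, _root_.map_zero]))
  exact h2

theorem exists_isSpectralSplitting (T : E →L[ℂ] E) [IsStarNormal T] {J : E → E}
    (hJ : IsQuatStructure J) (hTJ : ∀ x, T (J x) = J (T x)) {ι : Type*} (g : ι → ℂ) (v : ι → ℝ)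
    (hv : ∀ t, 0 < v t ∧ v t ≤ 1) {C : ℝ} (hC : 0 ≤ C)
    (hg : ∀ s t, ‖g s - g t‖ ≤ C * |v s - v t|)
    (hσ : ∀ z ∈ spectrum ℂ T, ∃ t, upperFold z = g t) :
    ∃ P R R', IsSpectralSplitting T J C P R R' := by
  let K : Set ℂ := Metric.closedBall 0 (‖T‖ * ‖(1 : E →L[ℂ] E)‖)
  have hsub : spectrum ℂ T ⊆ K := spectrum.subset_closedBall_norm_mul T
  have hKc : IsCompact K := isCompact_closedBall _ _
  have : CompactSpace K := isCompact_iff_compactSpace.1 hKc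
  have hK : ∀ z ∈ K, starRingEnd ℂ z ∈ K := fun z hz => by simpa [K] using hz
  let Ψ := extendedCalculus T hsub
  have hΨJ := extendedCalculus_quat T hsub hK hJ hTJ
  let F : ℝ → Set K := fun c => {z | ∃ t, upperFold z = g t ∧ v t ≤ c}
  let A : Set K := {z | 0 ≤ (z : ℂ).im}
  let A' : Set K := {z | (z : ℂ).im ≤ 0}
  have hmono : ∀ {a b}, a ≤ b → F a ⊆ F b := fun hab z ⟨t, h1, h2⟩ => ⟨t, h1, h2.trans hab⟩
  have hJmem : ∀ {G H : Set K}, (∀ z ∈ G, (⟨_, hK z z.2⟩ : K) ∈ H) →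
      ∀ x ∈ spectralSubspace Ψ G, J x ∈ spectralSubspace Ψ H := by
    intro G H hGH x hx f hf
    have h1 : Ψ (conjReflect hK f) x = 0 := hx _ fun z hz => by
      simp [conjReflect, hf _ (hGH z hz)]
    have h2 := hΨJ (conjReflect hK f) x
    have h3 : conjReflect hK (conjReflect hK f) = f := by
      ext z; simp [conjReflect]
    rw [h3, show extendedCalculus T hsub (conjReflect hK f) x = 0 from h1, hJ.map_zero] at h2
    exact h2.symm
  have hF : ∀ c, ∀ z ∈ F c, (⟨_, hK z z.2⟩ : K) ∈ F c := by
    rintro c z ⟨t, h1, h2⟩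
    exact ⟨t, by rw [← h1]; exact upperFold_conj z, h2⟩
  have hAA' : ∀ z ∈ A, (⟨_, hK z z.2⟩ : K) ∈ A' := fun z hz => by
    simpa [A, A'] using hz
  have hA'A : ∀ z ∈ A', (⟨_, hK z z.2⟩ : K) ∈ A := fun z hz => by
    simpa [A, A'] using hz
  have hmem : ∀ G x, spectralProj Ψ G x ∈ spectralSubspace Ψ G := fun G x =>
    Submodule.starProjection_apply_mem _ x
  have hfix : ∀ {G x}, x ∈ spectralSubspace Ψ G → spectralProj Ψ G x = x := fun hx =>
    Submodule.starProjection_eq_self_iff.2 hx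
  have hsymm : ∀ G x y, inner ℂ (spectralProj Ψ G x) y = inner ℂ x (spectralProj Ψ G y) :=
    fun G x y => Submodule.inner_starProjection_left_eq_right _ x y
  have hmul : ∀ a b x, a ≤ b → spectralProj Ψ (F b) (spectralProj Ψ (F a) x) =
      spectralProj Ψ (F a) x := fun a b x hab =>
    hfix (spectralSubspace_mono Ψ (hmono hab) (hmem _ x))
  refine ⟨fun c => spectralProj Ψ (F c), spectralProj Ψ A, spectralProj Ψ A', ?_⟩
  refine
    { symm := fun a => hsymm _
      mul := fun a b x => ?_
      zero := fun x => ?_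
      one := fun x => ?_
      map_J := fun a x => hJ.starProjection_map (hJmem (hF a)) (hJmem (hF a)) x
      symm_half := hsymm _
      idem_half := fun x => hfix (hmem _ x)
      comm_half := fun a x => spectralProj_comm Ψ _ _ x
      map_half := fun x => hJ.starProjection_map (hJmem hA'A) (hJmem hAA') x
      map_half' := fun x => hJ.starProjection_map (hJmem hAA') (hJmem hA'A) x
      comm_halves := fun x => spectralProj_comm Ψ _ _ x
      cover := fun x => ?_
      norm_sub_le := fun a b hab => ?_ }
  · rcases le_total a b with h | h
    · rw [min_eq_left h, spectralProj_comm, hmul a b x h]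
    · rw [min_eq_right h, hmul b a x h]
  · have h1 : F 0 = ∅ := by
      ext z
      simp only [F, Set.mem_ofPred_eq, Set.mem_empty_iff_false, iff_false]
      rintro ⟨t, -, h2⟩
      exact absurd (hv t).1 (not_lt.2 h2)
    have := hmem (F 0) x
    rw [h1, spectralSubspace_empty] at this
    simpa [h1] using this
  · refine hfix fun f hf => ?_
    have : Ψ f = 0 := extendedCalculus_eq_zero T hsub fun z hz => by
      obtain ⟨t, ht⟩ := hσ z hz
      exact hf z ⟨t, ht, (hv t).2⟩
    rw [this]; rfl
  · have h1 : x - spectralProj Ψ A x ∈ spectralSubspace Ψ A' :=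
      mem_spectralSubspace_of_inter Ψ (A := A) (B := A') (fun z => le_total 0 (z : ℂ).im)
        (Submodule.sub_starProjection_mem_orthogonal x)
    have h2 := hfix h1
    rw [_root_.map_sub, spectralProj_comm Ψ A' A x] at h2
    rw [add_sub_assoc, h2]
    abel
  · have hl : ∃ l : ℂ, ∀ z ∈ F b, z ∉ F a → ‖upperFold z - l‖ ≤ C * (b - a) := by
      by_cases hne : ∃ t, a < v t ∧ v t ≤ b
      · obtain ⟨t, ht1, ht2⟩ := hne
        refine ⟨g t, ?_⟩
        rintro z ⟨s, hs1, hs2⟩ hz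
        have hs3 : a < v s := by
          by_contra! hcon
          exact hz ⟨s, hs1, hcon⟩
        rw [hs1]
        refine (hg s t).trans (mul_le_mul_of_nonneg_left ?_ hC)
        rw [abs_le]
        constructor <;> linarith
      · push Not at hne
        refine ⟨0, ?_⟩
        rintro z ⟨s, hs1, hs2⟩ hz
        by_cases hs3 : a < v s
        · exact absurd hs2 (not_le.2 (hne s hs3))
        · exact absurd ⟨s, hs1, not_lt.1 hs3⟩ hz
    obtain ⟨l, hl⟩ := hl
    refine ⟨l, fun x hx hPx => ?_⟩
    let ψ : C(K, ℂ) := ⟨fun z => upperFold z, continuous_upperFold.comp continuous_subtype_val⟩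
    have hTx : T x = Ψ ψ x := by
      have hxA : x ∈ spectralSubspace Ψ A := hx ▸ hmem A x
      have h1 : Ψ (ContinuousMap.restrict K (ContinuousMap.id ℂ) - ψ) x = 0 := by
        refine hxA _ fun z hz => ?_
        have h3 : |(z : ℂ).im| = (z : ℂ).im := abs_of_nonneg hz
        have : upperFold z = z := by
          apply Complex.ext <;> simp [upperFold, h3]
        simp [ψ, this]
      rw [_root_.map_sub, sub_apply, sub_eq_zero,
        show Ψ (ContinuousMap.restrict K (ContinuousMap.id ℂ)) = T from
          extendedCalculus_id T hsub] at h1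
      exact h1
    have hPa : spectralProj Ψ (F a) x = 0 := by
      rw [← hPx, _root_.map_sub, spectralProj_comm, hmul a b x hab,
        hfix (hmem (F a) x), sub_self]
    have hPb : spectralProj Ψ (F b) x = x := by
      simpa [hPa] using hPx
    rw [hTx]
    refine norm_calculus_sub_le Ψ (mul_nonneg hC (sub_nonneg.2 hab)) hl (hPb ▸ hmem _ x) ?_
    exact (Submodule.starProjection_apply_eq_zero_iff _).1 hPa

end

namespace IsSpectralSplitting

variable {E : Type*} [NormedAddCommGroup E] [InnerProductSpace ℂ E]
  {T : E →L[ℂ] E} {J : E → E} {C : ℝ} {P : ℝ → E →L[ℂ] E} {R R' : E →L[ℂ] E}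

/-- The projection attached to the `4`-adic interval `(j / 4 ^ n, (j + 1) / 4 ^ n]`. -/
def cell (P : ℝ → E →L[ℂ] E) (n j : ℕ) : E →L[ℂ] E :=
  P (((j : ℝ) + 1) / 4 ^ n) - P ((j : ℝ) / 4 ^ n)

lemma cell_apply (n j : ℕ) (x : E) :
    cell P n j x = P (((j : ℝ) + 1) / 4 ^ n) x - P ((j : ℝ) / 4 ^ n) x := rfl

lemma comm (h : IsSpectralSplitting T J C P R R') (a b : ℝ) (x : E) :
    P a (P b x) = P b (P a x) := by rw [h.mul, h.mul, min_comm]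

lemma cell_comm (h : IsSpectralSplitting T J C P R R') (n j n' j' : ℕ) (x : E) :
    cell P n j (cell P n' j' x) = cell P n' j' (cell P n j x) := by
  simp only [cell_apply, map_sub, h.comm _ (((j' : ℝ) + 1) / 4 ^ n'),
    h.comm _ ((j' : ℝ) / 4 ^ n')]
  abel

lemma cell_cell (h : IsSpectralSplitting T J C P R R') {n n' : ℕ} (hn : n ≤ n') (j j' : ℕ)
    (x : E) : cell P n j (cell P n' j' x) =
      if j' / 4 ^ (n' - n) = j then cell P n' j' x else 0 := by
  obtain ⟨k, rfl⟩ := Nat.exists_eq_add_of_le hn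
  have hk : 0 < 4 ^ k := by positivity
  have e1 : (j : ℝ) / 4 ^ n = ((j * 4 ^ k : ℕ) : ℝ) / 4 ^ (n + k) := by
    rw [pow_add]; push_cast; field_simp
  have e2 : ((j : ℝ) + 1) / 4 ^ n = (((j + 1) * 4 ^ k : ℕ) : ℝ) / 4 ^ (n + k) := by
    rw [pow_add]; push_cast; field_simp
  have e3 : ((j' : ℝ) + 1) / 4 ^ (n + k) = ((j' + 1 : ℕ) : ℝ) / 4 ^ (n + k) := by push_cast; rfl
  have hle : ∀ {a b : ℕ}, a ≤ b → (a : ℝ) / 4 ^ (n + k) ≤ (b : ℝ) / 4 ^ (n + k) := fun hab => by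
    gcongr
  simp only [cell_apply, map_sub, h.mul, e1, e2, e3, Nat.add_sub_cancel_left]
  have hjj : j * 4 ^ k ≤ (j + 1) * 4 ^ k := Nat.mul_le_mul_right _ (Nat.le_succ j)
  split_ifs with hj
  · have h1 : j * 4 ^ k ≤ j' := hj ▸ Nat.div_mul_le_self j' (4 ^ k)
    have h2 : j' + 1 ≤ (j + 1) * 4 ^ k := by
      rw [← hj, mul_comm]; exact Nat.lt_mul_div_succ j' hk
    rw [min_eq_right (hle h2), min_eq_right (hle ((Nat.le_succ j').trans h2)),
      min_eq_left (hle (h1.trans (Nat.le_succ j'))), min_eq_left (hle h1)]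
    abel
  · rcases Nat.lt_or_ge j' (j * 4 ^ k) with h1 | h1
    · rw [min_eq_right (hle (Nat.succ_le_of_lt (h1.trans_le hjj))),
        min_eq_right (hle (h1.le.trans hjj)),
        min_eq_right (hle (Nat.succ_le_of_lt h1)), min_eq_right (hle h1.le)]
      abel
    · have h2 : (j + 1) * 4 ^ k ≤ j' := by
        by_contra! hcon
        refine hj (le_antisymm ?_ ((Nat.le_div_iff_mul_le hk).2 h1))
        exact Nat.lt_succ_iff.1 ((Nat.div_lt_iff_lt_mul hk).2 hcon)
      rw [min_eq_left (hle (h2.trans (Nat.le_succ j'))), min_eq_left (hle h2),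
        min_eq_left (hle (hjj.trans (h2.trans (Nat.le_succ j')))), min_eq_left (hle (hjj.trans h2))]
      abel

lemma cell_symm (h : IsSpectralSplitting T J C P R R') (n j : ℕ) (x y : E) :
    inner ℂ (cell P n j x) y = inner ℂ x (cell P n j y) := by
  simp only [cell_apply, inner_sub_left, inner_sub_right, h.symm]

lemma cell_map (h : IsSpectralSplitting T J C P R R') (hJ : IsQuatStructure J) (n j : ℕ) (x : E) :
    cell P n j (J x) = J (cell P n j x) := by
  simp only [cell_apply, hJ.map_sub, h.map_J]

lemma half_cell (h : IsSpectralSplitting T J C P R R') (n j : ℕ) (x : E) :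
    R (cell P n j x) = cell P n j (R x) := by
  simp only [cell_apply, map_sub, h.comm_half]

lemma sum_cell (h : IsSpectralSplitting T J C P R R') (n : ℕ) (x : E) :
    ∑ j ∈ Finset.range (4 ^ n), cell P n j x = x := by
  have : ∀ j : ℕ, cell P n j x = P (((j + 1 : ℕ) : ℝ) / 4 ^ n) x - P ((j : ℝ) / 4 ^ n) x :=
    fun j => by rw [cell_apply]; push_cast; rfl
  simp only [this]
  rw [Finset.sum_range_sub (fun j : ℕ => P ((j : ℝ) / 4 ^ n) x)]
  have : ((4 ^ n : ℕ) : ℝ) / 4 ^ n = 1 := by push_cast; field_simp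
  rw [this]
  simp [h.zero, h.one]

/-- The index of the vector in position `m` of the enumeration by blocks. -/
def blockLevel (m : ℕ) : ℕ := Nat.log 8 m

def blockCell (m : ℕ) : ℕ := (m - 8 ^ blockLevel m) % 4 ^ blockLevel m

def blockIndex (m : ℕ) : ℕ := (m - 8 ^ blockLevel m) / 4 ^ blockLevel m

lemma block_add {n i j : ℕ} (hi : i < 7 * 2 ^ n) (hj : j < 4 ^ n) :
    8 ^ n + i * 4 ^ n + j < 8 ^ (n + 1) ∧ blockLevel (8 ^ n + i * 4 ^ n + j) = n ∧
      blockCell (8 ^ n + i * 4 ^ n + j) = j ∧ blockIndex (8 ^ n + i * 4 ^ n + j) = i := by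
  have h8 : (8 : ℕ) ^ n = 2 ^ n * 4 ^ n := by rw [← mul_pow]; norm_num
  have hlt : 8 ^ n + i * 4 ^ n + j < 8 ^ (n + 1) := by
    rw [pow_succ, h8]
    nlinarith [Nat.mul_le_mul_right (4 ^ n) (Nat.succ_le_of_lt hi)]
  have hlog : blockLevel (8 ^ n + i * 4 ^ n + j) = n :=
    (Nat.log_eq_iff (Or.inr ⟨by norm_num, by positivity⟩)).2 ⟨by rw [add_assoc]; exact Nat.le_add_right _ _, hlt⟩
  refine ⟨hlt, hlog, ?_, ?_⟩
  · rw [blockCell, hlog, add_assoc, Nat.add_sub_cancel_left, Nat.mul_add_mod', Nat.mod_eq_of_lt hj]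
  · rw [blockIndex, hlog, add_assoc, Nat.add_sub_cancel_left, mul_comm, Nat.mul_add_div (by positivity),
      Nat.div_eq_of_lt hj, add_zero]

lemma pow_blockLevel_le {m : ℕ} (hm : m ≠ 0) : 8 ^ blockLevel m ≤ m := Nat.pow_log_le_self 8 hm

lemma lt_pow_blockLevel (m : ℕ) : m < 8 ^ (blockLevel m + 1) :=
  Nat.lt_pow_succ_log_self (by norm_num) m

lemma blockIndex_lt {m : ℕ} (hm : m ≠ 0) : blockIndex m < 7 * 2 ^ blockLevel m := by
  rw [blockIndex, Nat.div_lt_iff_lt_mul (by positivity), mul_assoc, ← mul_pow]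
  have h1 := lt_pow_blockLevel m
  have h2 := pow_blockLevel_le hm
  rw [pow_succ] at h1
  norm_num
  omega

lemma blockCell_lt (m : ℕ) : blockCell m < 4 ^ blockLevel m := Nat.mod_lt _ (by positivity)

end IsSpectralSplitting

lemma summable_blockLevel :
    Summable fun m : ℕ => ((16 : ℝ) ^ IsSpectralSplitting.blockLevel m)⁻¹ := by
  have h1 : Summable fun m : ℕ => 16 * ((m : ℝ) ^ (4 / 3 : ℝ))⁻¹ :=
    (Real.summable_nat_rpow_inv.2 (by norm_num)).mul_left 16
  refine Summable.of_norm_bounded_eventually_nat h1 ?_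
  filter_upwards [eventually_gt_atTop 0] with m hm
  rw [Real.norm_of_nonneg (by positivity)]
  have hm' : (0 : ℝ) < (m : ℝ) ^ (4 / 3 : ℝ) := Real.rpow_pos_of_pos (by exact_mod_cast hm) _
  rw [← div_eq_mul_inv, le_div_iff₀ hm', inv_mul_le_iff₀ (by positivity)]
  have h2 : (m : ℝ) ≤ 8 ^ (IsSpectralSplitting.blockLevel m + 1) := by
    exact_mod_cast (IsSpectralSplitting.lt_pow_blockLevel m).le
  calc (m : ℝ) ^ (4 / 3 : ℝ) ≤ ((8 : ℝ) ^ (IsSpectralSplitting.blockLevel m + 1)) ^ (4 / 3 : ℝ) :=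
        Real.rpow_le_rpow (by positivity) h2 (by norm_num)
    _ = 16 ^ (IsSpectralSplitting.blockLevel m + 1) := by
        rw [← Real.rpow_natCast, ← Real.rpow_mul (by norm_num), mul_comm, Real.rpow_mul (by norm_num),
          Real.rpow_natCast]
        congr 1
        rw [show (8 : ℝ) = 2 ^ (3 : ℝ) by norm_num, ← Real.rpow_mul (by norm_num)]
        norm_num
    _ = _ := by rw [pow_succ]

namespace IsSpectralSplitting

variable {E : Type*} [NormedAddCommGroup E] [InnerProductSpace ℂ E]
  {T : E →L[ℂ] E} {J : E → E} {C : ℝ} {P : ℝ → E →L[ℂ] E} {R R' : E →L[ℂ] E}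

/-- The truncated enumeration of the vectors `cell P n j (x i)` by blocks. -/
def blockSeq (P : ℝ → E →L[ℂ] E) (c : ℕ) (x : ℕ → E) (m : ℕ) : E :=
  if m < 8 ^ c then 0 else cell P (blockLevel m) (blockCell m) (x (blockIndex m))

/-- The complex span of the first vectors of a sequence and of their images under `J`. -/
def pairSpan (J : E → E) (f : ℕ → E) (m : ℕ) : Submodule ℂ E :=
  Submodule.span ℂ (f '' Set.Iio m ∪ (fun l => J (f l)) '' Set.Iio m)

instance (f : ℕ → E) (m : ℕ) : FiniteDimensional ℂ (pairSpan J f m) :=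
  FiniteDimensional.span_of_finite ℂ
    (((Set.finite_Iio m).image _).union ((Set.finite_Iio m).image _))

lemma mem_pairSpan {f : ℕ → E} {l m : ℕ} (h : l < m) : f l ∈ pairSpan J f m :=
  Submodule.subset_span (Or.inl ⟨l, h, rfl⟩)

lemma map_mem_pairSpan {f : ℕ → E} {l m : ℕ} (h : l < m) : J (f l) ∈ pairSpan J f m :=
  Submodule.subset_span (Or.inr ⟨l, h, rfl⟩)

lemma pairSpan_le {f : ℕ → E} {m : ℕ} {Z : Submodule ℂ E} (h1 : ∀ l < m, f l ∈ Z)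
    (h2 : ∀ l < m, J (f l) ∈ Z) : pairSpan J f m ≤ Z := by
  refine Submodule.span_le.2 ?_
  rintro _ (⟨l, hl, rfl⟩ | ⟨l, hl, rfl⟩)
  · exact h1 l hl
  · exact h2 l hl

lemma pairSpan_mono (f : ℕ → E) {l m : ℕ} (h : l ≤ m) : pairSpan J f l ≤ pairSpan J f m :=
  pairSpan_le (fun _ hk => mem_pairSpan (hk.trans_le h)) fun _ hk => map_mem_pairSpan (hk.trans_le h)

lemma _root_.IsQuatStructure.map_mem_span (hJ : IsQuatStructure J) {s : Set E}
    {Z : Submodule ℂ E} (hs : ∀ y ∈ s, J y ∈ Z) {y : E} (hy : y ∈ Submodule.span ℂ s) :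
    J y ∈ Z := by
  induction hy using Submodule.span_induction with
  | mem y hy => exact hs y hy
  | zero => rw [hJ.map_zero]; exact Z.zero_mem
  | add y z _ _ hy hz => rw [hJ.map_add]; exact Z.add_mem hy hz
  | smul c y _ hy => rw [hJ.map_smul]; exact Z.smul_mem _ hy

lemma map_pairSpan (hJ : IsQuatStructure J) {f : ℕ → E} {m : ℕ} {y : E}
    (hy : y ∈ pairSpan J f m) : J y ∈ pairSpan J f m := by
  refine hJ.map_mem_span ?_ hy
  rintro _ (⟨l, hl, rfl⟩ | ⟨l, hl, rfl⟩)
  · exact map_mem_pairSpan hl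
  · simp only [hJ.sq]
    exact Submodule.neg_mem _ (mem_pairSpan hl)

/-- Gram-Schmidt orthogonalization over the quaternions. -/
def pairGram (J : E → E) (f : ℕ → E) (m : ℕ) : E := f m - (pairSpan J f m).starProjection (f m)

lemma inner_pairGram {f : ℕ → E} {m : ℕ} {y : E} (hy : y ∈ pairSpan J f m) :
    inner ℂ (pairGram J f m) y = 0 :=
  Submodule.starProjection_inner_eq_zero _ _ hy

lemma pairGram_mem (f : ℕ → E) {l m : ℕ} (h : l < m) : pairGram J f l ∈ pairSpan J f m :=
  Submodule.sub_mem _ (mem_pairSpan h)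
    (pairSpan_mono f h.le (Submodule.starProjection_apply_mem _ _))

lemma pairGram_orthogonal (hJ : IsQuatStructure J) (f : ℕ → E) {l m : ℕ} (h : m ≠ l) :
    inner ℂ (pairGram J f m) (pairGram J f l) = 0 ∧
      inner ℂ (pairGram J f m) (J (pairGram J f l)) = 0 := by
  rcases lt_or_gt_of_ne h with h | h
  · rw [hJ.inner_right, ← inner_conj_symm, inner_pairGram (pairGram_mem f h),
      inner_pairGram (map_pairSpan hJ (pairGram_mem f h))]
    simp
  · exact ⟨inner_pairGram (pairGram_mem f h), inner_pairGram (map_pairSpan hJ (pairGram_mem f h))⟩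

lemma mem_of_pairGram_mem (f : ℕ → E) {Z : Submodule ℂ E}
    (hZ : ∀ y ∈ Z, J y ∈ Z) (h : ∀ m, pairGram J f m ∈ Z) (m : ℕ) : f m ∈ Z := by
  induction m using Nat.strong_induction_on with
  | _ m ih =>
    have := Z.add_mem (h m) (pairSpan_le (J := J) ih (fun l hl => hZ _ (ih l hl))
      (Submodule.starProjection_apply_mem (pairSpan J f m) (f m)))
    simpa [pairGram] using this

/-- The projection onto the half of the parent of the cell of position `m`. -/
def parent (P : ℝ → E →L[ℂ] E) (R : E →L[ℂ] E) (m : ℕ) : E →L[ℂ] E :=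
  R ∘L cell P (blockLevel m - 1) (blockCell m / 4)

section

variable {c : ℕ} {x : ℕ → E}

lemma blockLevel_ge {m : ℕ} (hm : 8 ^ c ≤ m) : c ≤ blockLevel m :=
  Nat.le_log_of_pow_le (by norm_num) hm

lemma half_cell_mem (h : IsSpectralSplitting T J C P R R') (hJ : IsQuatStructure J)
    (hx : ∀ i, R (x i) = x i) (hx' : ∀ i, R (J (x i)) = 0 ∨ R (J (x i)) = J (x i))
    {Z : Submodule ℂ E} {n j i : ℕ} (hZ : cell P n j (x i) ∈ Z) (hZ' : J (cell P n j (x i)) ∈ Z) :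
    R (cell P n j (x i)) ∈ Z ∧ R (J (cell P n j (x i))) ∈ Z := by
  refine ⟨by rwa [h.half_cell, hx], ?_⟩
  rw [← h.cell_map hJ, h.half_cell]
  rcases hx' i with h0 | h0
  · rw [h0, _root_.map_zero]; exact Z.zero_mem
  · rw [h0, h.cell_map hJ]; exact hZ'

lemma parent_mem (h : IsSpectralSplitting T J C P R R') (hJ : IsQuatStructure J) (hc : 1 ≤ c)
    (hx : ∀ i, R (x i) = x i) (hx' : ∀ i, R (J (x i)) = 0 ∨ R (J (x i)) = J (x i))
    {l m : ℕ} (hlm : l < m) :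
    parent P R m (blockSeq P c x l) ∈ pairSpan J (blockSeq P c x) m ∧
      parent P R m (J (blockSeq P c x l)) ∈ pairSpan J (blockSeq P c x) m := by
  set Z := pairSpan J (blockSeq P c x) m with hZ
  have hJZ : ∀ y ∈ Z, J y ∈ Z := fun y hy => map_pairSpan hJ hy
  have hseq : ∀ {k}, 8 ^ c ≤ k → blockSeq P c x k =
      cell P (blockLevel k) (blockCell k) (x (blockIndex k)) := fun hk => by
    rw [blockSeq, if_neg (not_lt.2 hk)]
  by_cases hl : l < 8 ^ c
  · have : blockSeq P c x l = 0 := by rw [blockSeq, if_pos hl]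
    rw [this, hJ.map_zero, _root_.map_zero]
    exact ⟨Z.zero_mem, Z.zero_mem⟩
  push Not at hl
  have hl0 : l ≠ 0 := by have : 0 < 8 ^ c := by positivity
                         omega
  have hm0 : m ≠ 0 := by omega
  have hcl := blockLevel_ge hl
  have hlm' : blockLevel l ≤ blockLevel m := Nat.log_mono_right hlm.le
  have hfl : cell P (blockLevel l) (blockCell l) (x (blockIndex l)) ∈ Z := by
    rw [← hseq hl]; exact mem_pairSpan hlm
  rw [hseq hl]
  simp only [parent, ContinuousLinearMap.comp_apply]
  rw [h.cell_map hJ]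
  suffices hs : cell P (blockLevel m - 1) (blockCell m / 4)
      (cell P (blockLevel l) (blockCell l) (x (blockIndex l))) = 0 ∨ ∃ n j i,
      cell P (blockLevel m - 1) (blockCell m / 4)
      (cell P (blockLevel l) (blockCell l) (x (blockIndex l))) = cell P n j (x i) ∧
      cell P n j (x i) ∈ Z by
    rcases hs with h0 | ⟨n, j, i, h0, h1⟩
    · rw [h0, hJ.map_zero, _root_.map_zero]
      exact ⟨Z.zero_mem, Z.zero_mem⟩
    · rw [h0]
      exact h.half_cell_mem hJ hx hx' h1 (hJZ _ h1)
  rcases Nat.lt_or_ge (blockLevel l) (blockLevel m) with hlt | hge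
  · rw [h.cell_comm, h.cell_cell (by omega)]
    split_ifs
    · refine Or.inr ⟨_, _, _, rfl, ?_⟩
      have hi : blockIndex l < 7 * 2 ^ (blockLevel m - 1) :=
        (blockIndex_lt hl0).trans_le
          (Nat.mul_le_mul_left _ (Nat.pow_le_pow_right (by norm_num) (by omega)))
      have hj : blockCell m / 4 < 4 ^ (blockLevel m - 1) := by
        rw [Nat.div_lt_iff_lt_mul (by norm_num), ← pow_succ,
          show blockLevel m - 1 + 1 = blockLevel m by omega]
        exact blockCell_lt m
      obtain ⟨h1, h2, h3, h4⟩ := block_add hi hj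
      have h5 : 8 ^ c ≤ 8 ^ (blockLevel m - 1) + blockIndex l * 4 ^ (blockLevel m - 1) +
          blockCell m / 4 := by
        have : 8 ^ c ≤ 8 ^ (blockLevel m - 1) := Nat.pow_le_pow_right (by norm_num) (by omega)
        omega
      have h6 := hseq h5
      rw [h2, h3, h4] at h6
      rw [← h6]
      refine mem_pairSpan (h1.trans_le ?_)
      rw [show blockLevel m - 1 + 1 = blockLevel m by omega]
      exact pow_blockLevel_le hm0
    · exact Or.inl rfl
  · rw [h.cell_cell (by omega)]
    split_ifs
    · exact Or.inr ⟨_, _, _, rfl, hfl⟩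
    · exact Or.inl rfl

lemma parent_symm (h : IsSpectralSplitting T J C P R R') (m : ℕ) (y z : E) :
    inner ℂ (parent P R m y) z = inner ℂ y (parent P R m z) := by
  simp only [parent, ContinuousLinearMap.comp_apply]
  rw [h.symm_half, h.cell_symm, h.half_cell]

lemma parent_blockSeq (h : IsSpectralSplitting T J C P R R') (hx : ∀ i, R (x i) = x i) (m : ℕ) :
    parent P R m (blockSeq P c x m) = blockSeq P c x m := by
  rw [blockSeq]
  split_ifs with hm
  · exact _root_.map_zero _
  · simp only [parent, ContinuousLinearMap.comp_apply]
    rw [h.cell_cell (by omega), if_pos, h.half_cell, hx]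
    rcases Nat.eq_zero_or_pos (blockLevel m) with h0 | h0
    · have := blockCell_lt m
      rw [h0] at this ⊢
      simp at this
      simp [this]
    · rw [show blockLevel m - (blockLevel m - 1) = 1 by omega, pow_one]

lemma parent_pairGram (h : IsSpectralSplitting T J C P R R') (hJ : IsQuatStructure J) (hc : 1 ≤ c)
    (hx : ∀ i, R (x i) = x i) (hx' : ∀ i, R (J (x i)) = 0 ∨ R (J (x i)) = J (x i)) (m : ℕ) :
    parent P R m (pairGram J (blockSeq P c x) m) = pairGram J (blockSeq P c x) m := by
  have hU : ∀ y ∈ pairSpan J (blockSeq P c x) m,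
      parent P R m y ∈ pairSpan J (blockSeq P c x) m := by
    have : pairSpan J (blockSeq P c x) m ≤
        (pairSpan J (blockSeq P c x) m).comap (parent P R m).toLinearMap :=
      pairSpan_le (fun l hl => (h.parent_mem hJ hc hx hx' hl).1)
        (fun l hl => (h.parent_mem hJ hc hx hx' hl).2)
    exact this
  have hp : (pairSpan J (blockSeq P c x) m).starProjection (blockSeq P c x m) =
      parent P R m ((pairSpan J (blockSeq P c x) m).starProjection (blockSeq P c x m)) := by
    refine Submodule.eq_starProjection_of_mem_of_inner_eq_zero
      (hU _ (Submodule.starProjection_apply_mem _ _)) fun w hw => ?_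
    conv_lhs => rw [← h.parent_blockSeq hx m (c := c)]
    rw [← map_sub, h.parent_symm]
    nth_rewrite 1 [h.parent_blockSeq hx]
    exact Submodule.starProjection_inner_eq_zero _ _ (hU w hw)
  rw [pairGram, map_sub, ← hp, h.parent_blockSeq hx]

lemma exists_norm_sub_le (h : IsSpectralSplitting T J C P R R') (hJ : IsQuatStructure J)
    (hc : 1 ≤ c) (hx : ∀ i, R (x i) = x i)
    (hx' : ∀ i, R (J (x i)) = 0 ∨ R (J (x i)) = J (x i)) (m : ℕ) :
    ∃ l : ℂ, ‖T (pairGram J (blockSeq P c x) m) - l • pairGram J (blockSeq P c x) m‖ ≤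
      (if m < 8 ^ c then 0 else 4 * C * (4 ^ blockLevel m)⁻¹) *
        ‖pairGram J (blockSeq P c x) m‖ := by
  split_ifs with hm
  · have : pairGram J (blockSeq P c x) m = 0 := by
      rw [pairGram, blockSeq, if_pos hm, _root_.map_zero, sub_zero]
    simp [this]
  push Not at hm
  have hg := h.parent_pairGram hJ hc hx hx' m
  set g := pairGram J (blockSeq P c x) m
  have hRg : R g = g := by
    rw [← hg]
    simp only [parent, ContinuousLinearMap.comp_apply, h.idem_half]
  have hcell : cell P (blockLevel m - 1) (blockCell m / 4) g = g := by
    conv_rhs => rw [← hg]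
    simp only [parent, ContinuousLinearMap.comp_apply, h.half_cell, hRg]
  obtain ⟨l, hl⟩ := h.norm_sub_le (((blockCell m / 4 : ℕ) : ℝ) / 4 ^ (blockLevel m - 1))
    ((((blockCell m / 4 : ℕ) : ℝ) + 1) / 4 ^ (blockLevel m - 1)) (by gcongr; linarith)
  refine ⟨l, (hl g hRg hcell).trans_eq ?_⟩
  have h1 : 1 ≤ blockLevel m := hc.trans (blockLevel_ge hm)
  congr 1
  have : (4 : ℝ) ^ blockLevel m = 4 ^ (blockLevel m - 1) * 4 := by
    rw [← pow_succ, show blockLevel m - 1 + 1 = blockLevel m by omega]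
  rw [this]
  field_simp
  ring

lemma mem_of_pairGram_blockSeq_mem (h : IsSpectralSplitting T J C P R R')
    {Z : Submodule ℂ E} (hZ : ∀ y ∈ Z, J y ∈ Z) (hg : ∀ m, pairGram J (blockSeq P c x) m ∈ Z)
    (i : ℕ) : x i ∈ Z := by
  have hf := mem_of_pairGram_mem _ hZ hg
  let n := max c i
  have hi : i < 7 * 2 ^ n := by
    have h1 : n < 2 ^ n := Nat.lt_two_pow_self
    have h2 : i ≤ n := le_max_right _ _
    omega
  rw [← h.sum_cell n (x i)]
  refine Z.sum_mem fun j hj => ?_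
  obtain ⟨-, h2, h3, h4⟩ := block_add hi (Finset.mem_range.1 hj)
  have h5 := hf (8 ^ n + i * 4 ^ n + j)
  have h6 : 8 ^ c ≤ 8 ^ n + i * 4 ^ n + j := by
    have : 8 ^ c ≤ 8 ^ n := Nat.pow_le_pow_right (by norm_num) (le_max_left _ _)
    omega
  rwa [blockSeq, if_neg (not_lt.2 h6), h2, h3, h4] at h5

end

lemma exists_tail_lt (C : ℝ) {δ : ℝ} (hδ : 0 < δ) : ∃ c : ℕ, 1 ≤ c ∧
    (Summable fun m : ℕ => (if m < 8 ^ c then 0 else 4 * C * ((4 : ℝ) ^ blockLevel m)⁻¹) ^ 2) ∧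
    ∑' m : ℕ, (if m < 8 ^ c then 0 else 4 * C * ((4 : ℝ) ^ blockLevel m)⁻¹) ^ 2 < δ := by
  let s : ℕ → ℝ := fun m => 16 * C ^ 2 * ((16 : ℝ) ^ blockLevel m)⁻¹
  have hs : Summable s := summable_blockLevel.mul_left _
  have hlim := hs.hasSum.tendsto_sum_nat
  have hpow : Tendsto (fun c : ℕ => 8 ^ c) atTop atTop := tendsto_pow_atTop_atTop_of_one_lt
    (by norm_num)
  have hev := (hlim.comp hpow).eventually (lt_mem_nhds (sub_lt_self (∑' m, s m) hδ))
  obtain ⟨c, hc1, hc⟩ := ((eventually_ge_atTop 1).and hev).exists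
  have hsq : ∀ m : ℕ, (4 * C * ((4 : ℝ) ^ blockLevel m)⁻¹) ^ 2 = s m := fun m => by
    simp only [s]
    rw [mul_pow, mul_pow, inv_pow, ← pow_mul, mul_comm (blockLevel m), pow_mul]
    norm_num
  have hsum : HasSum (fun m : ℕ => (if m < 8 ^ c then 0 else
      4 * C * ((4 : ℝ) ^ blockLevel m)⁻¹) ^ 2) (∑' m, s m - ∑ m ∈ Finset.range (8 ^ c), s m) := by
    have h1 : HasSum (fun m => if m ∈ Finset.range (8 ^ c) then s m else 0)
        (∑ m ∈ Finset.range (8 ^ c), s m) := by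
      have h2 : ∑ m ∈ Finset.range (8 ^ c), (if m ∈ Finset.range (8 ^ c) then s m else 0) =
          ∑ m ∈ Finset.range (8 ^ c), s m := Finset.sum_congr rfl fun b hb => if_pos hb
      rw [← h2]
      exact hasSum_sum_of_ne_finset_zero fun b hb => if_neg hb
    have h3 : (fun m : ℕ => (if m < 8 ^ c then 0 else 4 * C * ((4 : ℝ) ^ blockLevel m)⁻¹) ^ 2) =
        fun m => s m - if m ∈ Finset.range (8 ^ c) then s m else 0 := by
      funext m
      simp only [Finset.mem_range]
      split_ifs
      · simp
      · rw [hsq, sub_zero]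
    rw [h3]
    exact hs.hasSum.sub h1
  refine ⟨c, hc1, hsum.summable, ?_⟩
  rw [hsum.tsum_eq]
  simp only [Function.comp] at hc
  linarith

/-- Vectors whose images under `J` are controlled by the half space projection `R`. -/
lemma exists_adapted_seq (h : IsSpectralSplitting T J C P R R') (hJ : IsQuatStructure J)
    {u : ℕ → E} (hu : Dense (Submodule.span ℂ (Set.range u) : Set E)) :
    ∃ x : ℕ → E, (∀ i, R (x i) = x i) ∧ (∀ i, R (J (x i)) = 0 ∨ R (J (x i)) = J (x i)) ∧
      ∀ Z : Submodule ℂ E, IsClosed (Z : Set E) → (∀ y ∈ Z, J y ∈ Z) → (∀ i, x i ∈ Z) →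
        Z = ⊤ := by
  have hidem' : ∀ y, R' (R' y) = R' y := fun y => by
    have hy : J (-J y) = y := by rw [hJ.map_neg, hJ.sq, neg_neg]
    rw [← hy, h.map_half', h.map_half', h.idem_half]
  refine ⟨fun k => if k % 2 = 0 then R (R' (u (k / 2))) else R (u (k / 2) - R' (u (k / 2))),
    fun i => ?_, fun i => ?_, fun Z hZc hZJ hZ => ?_⟩
  · dsimp only
    split_ifs <;> exact h.idem_half _
  · dsimp only
    split_ifs
    · right
      rw [h.map_half, ← h.comm_halves, hidem']
    · left
      rw [h.map_half, ← h.comm_halves, map_sub, hidem', sub_self, _root_.map_zero, hJ.map_zero]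
  · have key : ∀ S : E →L[ℂ] E, (∀ k, S (u k) ∈ Z) → ∀ y, S y ∈ Z := by
      intro S hS y
      have h1 : Submodule.span ℂ (Set.range u) ≤ Z.comap S.toLinearMap := by
        rw [Submodule.span_le]
        rintro _ ⟨k, rfl⟩
        exact hS k
      have h2 : IsClosed {y | S y ∈ Z} := hZc.preimage S.continuous
      exact h2.closure_subset_iff.2 h1 (hu y)
    have h1 : ∀ y, R (R' y) ∈ Z := key (R ∘L R') fun k => by
      have := hZ (2 * k)
      simpa using this
    have h2 : ∀ y, R (y - R' y) ∈ Z := fun y => by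
      have := key (R ∘L (1 - R')) (fun k => by
        have := hZ (2 * k + 1)
        dsimp only at this
        rw [if_neg (by omega), show (2 * k + 1) / 2 = k by omega] at this
        exact this) y
      exact this
    refine Submodule.eq_top_iff'.2 fun y => ?_
    have h3 := hZJ _ (h2 (-J y))
    have h4 : J (R (-J y - R' (-J y))) = R' y - R (R' y) := by
      rw [← h.map_half', hJ.map_sub, hJ.map_neg, hJ.sq, neg_neg, ← h.map_half, hJ.map_neg, hJ.sq,
        neg_neg, map_sub, h.comm_halves]
    rw [h4] at h3
    have h5 := Z.add_mem (Z.add_mem (h1 y) (h2 y)) h3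
    have h6 := h.cover y
    rw [map_sub] at h5
    have h7 : R (R' y) + (R y - R (R' y)) + (R' y - R (R' y)) = y := by
      nth_rewrite 6 [← h6]; abel
    rwa [h7] at h5

/-- Almost diagonalization along a quaternionic orthogonal system. -/
theorem exists_quasi_eigenvectors (h : IsSpectralSplitting T J C P R R') (hJ : IsQuatStructure J)
    {u : ℕ → E} (hu : Dense (Submodule.span ℂ (Set.range u) : Set E)) {δ : ℝ} (hδ : 0 < δ) :
    ∃ (g : ℕ → E) (l : ℕ → ℂ) (d : ℕ → ℝ),
      (∀ m k, m ≠ k → inner ℂ (g m) (g k) = 0 ∧ inner ℂ (g m) (J (g k)) = 0) ∧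
      (∀ Z : Submodule ℂ E, IsClosed (Z : Set E) → (∀ y ∈ Z, J y ∈ Z) → (∀ i, g i ∈ Z) → Z = ⊤) ∧
      (∀ m, ‖T (g m) - l m • g m‖ ≤ d m * ‖g m‖) ∧ (Summable fun m => d m ^ 2) ∧
      ∑' m, d m ^ 2 < δ := by
  obtain ⟨x, hx, hx', hZ⟩ := h.exists_adapted_seq hJ hu
  obtain ⟨c, hc, hsum, hlt⟩ := exists_tail_lt C hδ
  choose l hl using h.exists_norm_sub_le hJ hc hx hx'
  exact ⟨pairGram J (blockSeq P c x), l, _, fun m k hmk => pairGram_orthogonal hJ _ hmk,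
    fun Z hZc hZJ hZg => hZ Z hZc hZJ fun i => h.mem_of_pairGram_blockSeq_mem hZJ hZg i,
    hl, hsum, hlt⟩

end IsSpectralSplitting

lemma rsmul_apply (q : Hq) (x : Hsp) (n : ℕ) : rsmul q x n = x n * q := rfl

lemma rsmul_add (q : Hq) (x y : Hsp) : rsmul q (x + y) = rsmul q x + rsmul q y :=
  smul_add _ _ _

lemma add_rsmul (p q : Hq) (x : Hsp) : rsmul (p + q) x = rsmul p x + rsmul q x := by
  rw [rsmul, MulOpposite.op_add, add_smul]; rfl

lemma rsmul_mul (p q : Hq) (x : Hsp) : rsmul (p * q) x = rsmul q (rsmul p x) := by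
  rw [rsmul, MulOpposite.op_mul, mul_smul]; rfl

lemma one_rsmul (x : Hsp) : rsmul 1 x = x := one_smul _ x

lemma zero_rsmul (x : Hsp) : rsmul 0 x = 0 := zero_smul _ x

lemma rsmul_zero (q : Hq) : rsmul q 0 = 0 := smul_zero _

lemma neg_rsmul (q : Hq) (x : Hsp) : rsmul (-q) x = -rsmul q x := by
  rw [rsmul, MulOpposite.op_neg, neg_smul]; rfl

lemma hasSum_norm_sq (x : Hsp) : HasSum (fun n => ‖x n‖ ^ 2) (‖x‖ ^ 2) := by
  have := lp.hasSum_norm (p := 2) (by norm_num) x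
  simpa using this

lemma summable_qinner (x y : Hsp) : Summable fun n => star (x n) * y n := by
  refine Summable.of_norm_bounded
    (((hasSum_norm_sq x).summable.add (hasSum_norm_sq y).summable)) fun n => ?_
  rw [norm_mul, norm_star]
  nlinarith [sq_nonneg (‖x n‖ - ‖y n‖), sq_nonneg ‖x n‖, sq_nonneg ‖y n‖]

lemma qinner_add_left (x y z : Hsp) : qinner (x + y) z = qinner x z + qinner y z := by
  rw [qinner, qinner, qinner, ← (summable_qinner x z).tsum_add (summable_qinner y z)]
  simp [add_mul]

lemma qinner_add_right (x y z : Hsp) : qinner x (y + z) = qinner x y + qinner x z := by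
  rw [qinner, qinner, qinner, ← (summable_qinner x y).tsum_add (summable_qinner x z)]
  simp [mul_add]

lemma qinner_rsmul_right (q : Hq) (x y : Hsp) : qinner x (rsmul q y) = qinner x y * q := by
  rw [qinner, qinner, ← tsum_mul_right]
  simp [rsmul_apply, mul_assoc]

lemma qinner_rsmul_left (q : Hq) (x y : Hsp) : qinner (rsmul q x) y = star q * qinner x y := by
  rw [qinner, qinner, ← tsum_mul_left]
  simp [rsmul_apply, mul_assoc]

lemma star_qinner (x y : Hsp) : star (qinner x y) = qinner y x := by
  rw [qinner, qinner, tsum_star]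
  simp

lemma qinner_self (x : Hsp) : qinner x x = ((‖x‖ ^ 2 : ℝ) : Hq) := by
  have h := (hasSum_norm_sq x).map (algebraMap ℝ Hq) (algebraMapCLM ℝ Hq).continuous
  rw [qinner]
  refine Eq.trans ?_ h.tsum_eq
  refine tsum_congr fun n => ?_
  rw [Quaternion.star_mul_self, Quaternion.normSq_eq_norm_mul_self, ← pow_two]
  rfl

/-- The standard complex component of a quaternion. -/
def complexPart (q : Hq) : ℂ := ⟨q.re, q.imI⟩

lemma complexPart_add (p q : Hq) : complexPart (p + q) = complexPart p + complexPart q := by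
  apply Complex.ext <;> simp [complexPart]

lemma complexPart_coe_mul (z : ℂ) (q : Hq) :
    complexPart ((z : Hq) * q) = z * complexPart q := by
  apply Complex.ext <;> simp [complexPart]

lemma complexPart_star (q : Hq) : complexPart (star q) = starRingEnd ℂ (complexPart q) := by
  apply Complex.ext <;> simp [complexPart]

lemma star_coeComplex (z : ℂ) : star (z : Hq) = ((starRingEnd ℂ z : ℂ) : Hq) := by
  ext <;> simp

/-- The quaternion unit `j`. -/
def unitJ : Hq := ⟨0, 0, 1, 0⟩

@[simp] lemma unitJ_re : unitJ.re = 0 := rfl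

@[simp] lemma unitJ_imI : unitJ.imI = 0 := rfl

@[simp] lemma unitJ_imJ : unitJ.imJ = 1 := rfl

@[simp] lemma unitJ_imK : unitJ.imK = 0 := rfl

lemma eq_complexPart_sub (q : Hq) :
    q = (complexPart q : Hq) - (complexPart (q * unitJ) : Hq) * unitJ := by
  ext <;> simp [complexPart]

instance : Module ℂ Hsp where
  smul z x := rsmul (z : Hq) x
  one_smul x := by change rsmul ((1 : ℂ) : Hq) x = x; rw [Quaternion.coeComplex_one, one_rsmul]
  mul_smul z w x := by
    change rsmul ((z * w : ℂ) : Hq) x = rsmul (z : Hq) (rsmul (w : Hq) x)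
    rw [mul_comm, Quaternion.coeComplex_mul, rsmul_mul]
  smul_zero z := rsmul_zero _
  smul_add z x y := rsmul_add _ _ _
  add_smul z w x := by
    change rsmul ((z + w : ℂ) : Hq) x = rsmul (z : Hq) x + rsmul (w : Hq) x
    rw [Quaternion.coeComplex_add, add_rsmul]
  zero_smul x := by change rsmul ((0 : ℂ) : Hq) x = 0; rw [Quaternion.coeComplex_zero, zero_rsmul]

lemma complex_smul_def (z : ℂ) (x : Hsp) : z • x = rsmul (z : Hq) x := rfl

lemma norm_rsmul (q : Hq) (x : Hsp) : ‖rsmul q x‖ = ‖x‖ * ‖q‖ := by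
  have h1 := hasSum_norm_sq (rsmul q x)
  have h2 := (hasSum_norm_sq x).mul_right (‖q‖ ^ 2)
  simp only [rsmul_apply, norm_mul, mul_pow] at h1
  have h3 := h1.unique h2
  rw [← mul_pow] at h3
  exact (sq_eq_sq₀ (norm_nonneg _) (by positivity)).1 h3

lemma norm_coeComplex (z : ℂ) : ‖(z : Hq)‖ = ‖z‖ := by
  rw [← sq_eq_sq₀ (norm_nonneg _) (norm_nonneg _), pow_two, ← Quaternion.normSq_eq_norm_mul_self,
    Quaternion.normSq_def', ← Complex.normSq_eq_norm_sq, Complex.normSq_apply]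
  simp
  ring

instance : NormedSpace ℂ Hsp where
  norm_smul_le z x := by rw [complex_smul_def, norm_rsmul, norm_coeComplex, mul_comm]

instance : InnerProductSpace ℂ Hsp where
  inner x y := complexPart (qinner x y)
  norm_sq_eq_re_inner x := by
    change _ = (complexPart (qinner x x)).re
    rw [qinner_self]; rfl
  conj_inner_symm x y := by rw [← complexPart_star, star_qinner]
  add_left x y z := by rw [qinner_add_left, complexPart_add]
  smul_left x y z := by
    rw [complex_smul_def, qinner_rsmul_left, star_coeComplex, complexPart_coe_mul]

lemma inner_eq_complexPart (x y : Hsp) : inner ℂ x y = complexPart (qinner x y) := rfl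

lemma isQuatStructure_rsmul : IsQuatStructure (rsmul unitJ) where
  map_add := rsmul_add _
  map_smul c x := by
    rw [complex_smul_def, complex_smul_def, ← rsmul_mul, ← rsmul_mul]
    congr 1
    ext <;> simp
  inner_map x y := by
    rw [inner_eq_complexPart, inner_eq_complexPart, qinner_rsmul_left, qinner_rsmul_right,
      ← star_qinner x y]
    apply Complex.ext <;> simp [complexPart]
  sq x := by
    rw [← rsmul_mul]
    have : unitJ * unitJ = -1 := by ext <;> simp
    rw [this, neg_rsmul, one_rsmul]

lemma qinner_eq (x y : Hsp) :
    qinner x y = (inner ℂ x y : ℂ) - (inner ℂ x (rsmul unitJ y) : ℂ) * unitJ := by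
  rw [inner_eq_complexPart, inner_eq_complexPart, qinner_rsmul_right]
  exact eq_complexPart_sub _

lemma norm_unitJ : ‖unitJ‖ = 1 := by
  rw [← sq_eq_sq₀ (norm_nonneg _) zero_le_one, pow_two, ← Quaternion.normSq_eq_norm_mul_self,
    Quaternion.normSq_def']
  simp

lemma qinner_zero_left (x : Hsp) : qinner 0 x = 0 := by
  simp [qinner]

lemma QOp.IsRightLinear.app_sub {N : QOp} (h : N.IsRightLinear) {x y : Hsp} (hx : x ∈ N.dom)
    (hy : y ∈ N.dom) : x - y ∈ N.dom ∧ N.app (x - y) = N.app x - N.app y := by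
  have h1 := h.2.2 y hy (-1)
  rw [neg_rsmul, neg_rsmul, one_rsmul, one_rsmul] at h1
  have h2 := h.2.1 x hx _ h1.1
  rwa [h1.2, ← sub_eq_add_neg, ← sub_eq_add_neg] at h2

/-- The domain of a right linear operator as a complex subspace. -/
def QOp.IsRightLinear.domain {N : QOp} (h : N.IsRightLinear) : Submodule ℂ Hsp where
  carrier := N.dom
  add_mem' := fun hx hy => (h.2.1 _ hx _ hy).1
  zero_mem' := h.1
  smul_mem' := fun c _ hx => (h.2.2 _ hx c).1

/-- The domain of the adjoint as a complex subspace. -/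
def QOp.adjointDomain (N : QOp) : Submodule ℂ Hsp where
  carrier := {y | ContinuousOn (fun x => qinner y (N.app x)) N.dom}
  add_mem' := fun {y z} hy hz => by
    simp only [Set.mem_ofPred_eq, qinner_add_left]
    exact ContinuousOn.add hy hz
  zero_mem' := by simpa only [Set.mem_ofPred_eq, qinner_zero_left] using continuousOn_const
  smul_mem' := fun c y hy => by
    simp only [Set.mem_ofPred_eq, complex_smul_def, qinner_rsmul_left]
    exact continuousOn_const.mul hy

lemma QOp.mem_adjointDomain {N : QOp} {y : Hsp} :
    y ∈ N.adjointDomain ↔ ContinuousOn (fun x => qinner y (N.app x)) N.dom := Iff.rfl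

lemma norm_qinner_le_of_norm_inner_le {N : QOp} (h : N.IsRightLinear) {y : Hsp} {C : ℝ}
    (hC : ∀ x ∈ N.dom, ‖(inner ℂ y (N.app x) : ℂ)‖ ≤ C * ‖x‖) {x : Hsp} (hx : x ∈ N.dom) :
    ‖qinner y (N.app x)‖ ≤ 2 * C * ‖x‖ := by
  have hxj := h.2.2 x hx unitJ
  have h1 := hC x hx
  have h2 := hC _ hxj.1
  rw [hxj.2, norm_rsmul, norm_unitJ, mul_one] at h2
  rw [qinner_eq]
  refine (norm_sub_le _ _).trans ?_
  rw [norm_mul, norm_unitJ, mul_one, norm_coeComplex, norm_coeComplex]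
  linarith

lemma isNormalPair_of_isAdjointOf {N S : QOp} (hlin : N.IsRightLinear)
    (hdense : N.IsDenselyDefined) (hclosed : N.IsClosedOp) (hS : N.IsAdjointOf S)
    (hcomm : QOp.Eq (S.comp N) (N.comp S)) :
    IsNormalPair hlin.domain N.adjointDomain N.app S.app := by
  have hmem : ∀ y, y ∈ S.dom ↔ y ∈ N.adjointDomain := fun y => by rw [hS.1]; rfl
  have hdom := fun x => Set.ext_iff.1 hcomm.1 x
  refine ⟨fun x hx y hy => (hlin.2.1 x hx y hy).2, fun c x hx => (hlin.2.2 x hx c).2, hdense,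
    hclosed, ?_, ?_, ?_, ?_⟩
  · rintro y ⟨C, hC⟩
    refine QOp.mem_adjointDomain.2 (LipschitzOnWith.continuousOn (K := (2 * |C|).toNNReal) ?_)
    refine LipschitzOnWith.of_dist_le_mul fun x hx x' hx' => ?_
    have h1 := hlin.app_sub hx hx'
    have h2 : qinner y (N.app x) - qinner y (N.app x') = qinner y (N.app (x - x')) := by
      rw [sub_eq_iff_eq_add, ← qinner_add_right, h1.2, sub_add_cancel]
    rw [dist_eq_norm, dist_eq_norm, h2, Real.coe_toNNReal _ (by positivity)]
    exact norm_qinner_le_of_norm_inner_le hlin (fun x hx => (hC x hx).trans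
      (mul_le_mul_of_nonneg_right (le_abs_self C) (norm_nonneg _))) h1.1
  · intro y hy x hx
    rw [inner_eq_complexPart, inner_eq_complexPart, hS.2 y ((hmem y).2 hy) x hx]
  · intro x
    have := hdom x
    simp only [QOp.comp, Set.mem_ofPred_eq, hmem] at this
    exact this
  · intro x hx hNx
    exact hcomm.2 x ⟨hx, (hmem _).2 hNx⟩

lemma sphDeltaU_coe (N : QOp) (l : ℂ) (x : Hsp) :
    sphDeltaU N l x = IsNormalPair.quad N.app l.re (Complex.normSq l) x := by
  have h1 : (l : Hq) + star (l : Hq) = (((2 * l.re : ℝ) : ℂ) : Hq) := by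
    ext <;> simp [two_mul]
  have h2 : ((normSq (l : Hq) : ℝ) : Hq) = ((Complex.normSq l : ℂ) : Hq) := by
    rw [Quaternion.normSq_def', Complex.normSq_apply]
    ext <;> simp [pow_two]
  rw [sphDeltaU, IsNormalPair.quad, h1, h2]
  rfl

lemma isRegularPoint_of_inSphResolventU {N : QOp} (hlin : N.IsRightLinear) {l : ℂ}
    (h : inSphResolventU N l) : IsNormalPair.IsRegularPoint hlin.domain N.app l := by
  obtain ⟨h1, h2, M, h3⟩ := h
  rw [show sphDeltaU N l = IsNormalPair.quad N.app l.re (Complex.normSq l) from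
    funext (sphDeltaU_coe N l)] at h1 h2 h3
  exact ⟨fun x hx hNx => h1 x ⟨hx, hNx⟩, h2, M, fun x hx hNx => h3 x ⟨hx, hNx⟩⟩

lemma re_add_mul_coe_of_mem_QS {j : Hq} (hj : j ∈ QS) (a b : ℝ) :
    ((a : Hq) + j * (b : Hq)).re = a ∧ ‖((a : Hq) + j * (b : Hq)).im‖ = |b| := by
  have h0 : j.re = 0 := by
    have := congrArg QuaternionAlgebra.re hj.1
    simp at this
    linarith
  have him : j.im = j := by ext <;> simp [h0]
  refine ⟨by simp [h0], ?_⟩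
  have : ((a : Hq) + j * (b : Hq)).im = j * (b : Hq) := by ext <;> simp [h0]
  rw [this, norm_mul, hj.2, one_mul, Quaternion.norm_coe, Real.norm_eq_abs]

/-- The representative of a quaternion in the closed upper half plane. -/
def halfPlanePart (q : Hq) : ℂ := ⟨q.re, ‖q.im‖⟩

lemma upperFold_eq_halfPlanePart (l : ℂ) : upperFold l = halfPlanePart (l : Hq) := by
  have h : ‖((l : Hq)).im‖ = |l.im| := by
    rw [← sq_eq_sq₀ (norm_nonneg _) (abs_nonneg _), sq_abs, pow_two,
      ← Quaternion.normSq_eq_norm_mul_self, Quaternion.normSq_def']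
    simp
  rw [halfPlanePart, h]
  rfl

lemma norm_halfPlanePart_sub_le (p q : Hq) : ‖halfPlanePart p - halfPlanePart q‖ ≤ ‖p - q‖ := by
  refine le_of_sq_le_sq ?_ (norm_nonneg _)
  have h1 : ‖p - q‖ ^ 2 = (p.re - q.re) ^ 2 + ‖p.im - q.im‖ ^ 2 := by
    rw [pow_two, pow_two ‖p.im - q.im‖, ← Quaternion.normSq_eq_norm_mul_self,
      ← Quaternion.normSq_eq_norm_mul_self, Quaternion.normSq_def', Quaternion.normSq_def']
    simp
    ring
  have h2 := abs_norm_sub_norm_le p.im q.im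
  have h3 := (sq_abs (‖p.im‖ - ‖q.im‖)).symm.le.trans
    (pow_le_pow_left₀ (abs_nonneg _) h2 2)
  rw [h1, ← Complex.normSq_eq_norm_sq, Complex.normSq_apply]
  simp only [halfPlanePart, Complex.sub_re, Complex.sub_im]
  nlinarith

lemma halfPlanePart_eq_of_mem_circ {m : Hq} (hm : m ∈ QS) {K : Set Hq} {q : Hq}
    (hq : q ∈ circ m K) : ∃ k ∈ K, halfPlanePart q = halfPlanePart k := by
  obtain ⟨a, b, j, hj, hk, rfl⟩ := hq
  refine ⟨_, hk, ?_⟩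
  simp only [halfPlanePart, re_add_mul_coe_of_mem_QS hj, re_add_mul_coe_of_mem_QS hm]

lemma norm_upperFold (z : ℂ) : ‖upperFold z‖ = ‖z‖ := by
  rw [← sq_eq_sq₀ (norm_nonneg _) (norm_nonneg _), ← Complex.normSq_eq_norm_sq,
    ← Complex.normSq_eq_norm_sq, Complex.normSq_apply, Complex.normSq_apply]
  simp [upperFold]

/-- A curve of bounded variation is Lipschitz with respect to a bounded positive parameter. -/
lemma BoundedVariationOn.exists_lipschitz_parameter {E : Type*} [PseudoMetricSpace E]
    {γ : ℝ → E} {a b : ℝ} (hγ : BoundedVariationOn γ (Set.Icc a b)) :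
    ∃ (v : Set.Icc a b → ℝ) (C : ℝ), 0 ≤ C ∧ (∀ t, 0 < v t ∧ v t ≤ 1) ∧
      ∀ s t : Set.Icc a b, dist (γ s) (γ t) ≤ C * |v s - v t| := by
  have hl := hγ.locallyBoundedVariationOn
  rcases le_or_gt a b with hab | hab
  swap
  · exact ⟨fun _ => 1, 0, le_rfl, fun _ => ⟨one_pos, le_rfl⟩, fun s =>
      absurd (s.2.1.trans s.2.2) (not_le.2 hab)⟩
  have ha : a ∈ Set.Icc a b := Set.left_mem_Icc.2 hab
  have hb : b ∈ Set.Icc a b := Set.right_mem_Icc.2 hab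
  set V := variationOnFromTo γ (Set.Icc a b) a with hV
  have hmono : MonotoneOn V (Set.Icc a b) := variationOnFromTo.monotoneOn hl ha
  have h0 : V a = 0 := variationOnFromTo.self _ _ _
  have hpos : 0 ≤ V b := h0 ▸ hmono ha hb hab
  have key : ∀ s t, s ∈ Set.Icc a b → t ∈ Set.Icc a b → s ≤ t →
      dist (γ s) (γ t) ≤ |V s - V t| := by
    intro s t hs ht hst
    have h2 : V t - V s = variationOnFromTo γ (Set.Icc a b) s t := by
      rw [sub_eq_iff_eq_add, add_comm]
      exact (variationOnFromTo.add hl ha hs ht).symm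
    rw [abs_sub_comm, h2]
    refine le_trans ?_ (le_abs_self _)
    rw [variationOnFromTo.eq_of_le _ _ hst, dist_edist]
    refine ENNReal.toReal_mono (hl s t hs ht) (eVariationOn.edist_le _ ⟨hs, le_rfl, hst⟩
      ⟨ht, hst, le_rfl⟩)
  refine ⟨fun t => (V t + 1) / (V b + 1), V b + 1, by positivity, fun t => ?_, fun s t => ?_⟩
  · have h1 : 0 ≤ V t := h0 ▸ hmono ha t.2 t.2.1
    have h2 : V t ≤ V b := hmono t.2 hb t.2.2
    exact ⟨by positivity, (div_le_one (by positivity)).2 (by linarith)⟩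
  · rw [← sub_div, abs_div, abs_of_pos (show 0 < V b + 1 by positivity),
      mul_div_cancel₀ _ (by positivity), add_sub_add_right_eq_sub]
    rcases le_total (s : ℝ) t with h | h
    · exact key s t s.2 t.2 h
    · rw [dist_comm, abs_sub_comm]
      exact key t s t.2 s.2 h

instance : TopologicalSpace.SeparableSpace Hsp := by
  set A : Set Hsp := ⋃ n : ℕ, Set.range (lp.single (E := fun _ : ℕ => Hq) 2 n) with hA
  have hs : TopologicalSpace.IsSeparable A := TopologicalSpace.IsSeparable.iUnion fun n =>
    TopologicalSpace.isSeparable_range (lp.isometry_single n).continuous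
  have hs' := (hs.span (R := ℝ)).closure
  refine TopologicalSpace.isSeparable_univ_iff.1 (hs'.mono fun x _ => ?_)
  refine mem_closure_of_tendsto (lp.hasSum_single (p := 2) (by norm_num) x)
    (Eventually.of_forall fun s => ?_)
  exact sum_mem fun n _ => Submodule.subset_span (Set.mem_iUnion.2 ⟨n, Set.mem_range_self _⟩)

theorem exists_quasi_eigenvectors_of_sphSpectrumU {m : Hq} (hm : m ∈ QS)
    {N : QOp} (hlin : N.IsRightLinear) (hdense : N.IsDenselyDefined)
    (hclosed : N.IsClosedOp) (hnormal : N.IsNormal) {K : Set Hq} {γ : ℝ → Hq}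
    (hγ : ContinuousOn γ (Set.Icc 0 1)) (hγ' : BoundedVariationOn γ (Set.Icc 0 1))
    (hK : K ⊆ γ '' Set.Icc 0 1) (hspec : sphSpectrumU N = circ m K) {δ : ℝ} (hδ : 0 < δ) :
    N.dom = Set.univ ∧ ∃ (T : Hsp →L[ℂ] Hsp) (g : ℕ → Hsp) (l : ℕ → ℂ) (d : ℕ → ℝ),
      (∀ x, T x = N.app x) ∧
      (∀ i k, i ≠ k → (inner ℂ (g i) (g k) : ℂ) = 0 ∧
        (inner ℂ (g i) (rsmul unitJ (g k)) : ℂ) = 0) ∧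
      (∀ Z : Submodule ℂ Hsp, IsClosed (Z : Set Hsp) → (∀ y ∈ Z, rsmul unitJ y ∈ Z) →
        (∀ i, g i ∈ Z) → Z = ⊤) ∧
      (∀ i, ‖T (g i) - l i • g i‖ ≤ d i * ‖g i‖) ∧
      (Summable fun i => d i ^ 2) ∧ ∑' i, d i ^ 2 < δ := by
  obtain ⟨S, hS, hcomm⟩ := hnormal
  have hpair := isNormalPair_of_isAdjointOf hlin hdense hclosed hS hcomm
  have hcurve : ∀ l : ℂ, ¬IsNormalPair.IsRegularPoint hlin.domain N.app l →
      ∃ t : Set.Icc (0 : ℝ) 1, upperFold l = halfPlanePart (γ t) := by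
    intro l hl
    have h1 : (l : Hq) ∈ circ m K := hspec ▸ fun h => hl (isRegularPoint_of_inSphResolventU hlin h)
    obtain ⟨k, hk, hk'⟩ := halfPlanePart_eq_of_mem_circ hm h1
    obtain ⟨t, ht, rfl⟩ := hK hk
    exact ⟨⟨t, ht⟩, by rw [upperFold_eq_halfPlanePart, hk']⟩
  obtain ⟨r, hr⟩ : ∃ r : ℝ, ∀ t ∈ Set.Icc (0 : ℝ) 1, ‖γ t‖ ≤ r :=
    isCompact_Icc.exists_bound_of_continuousOn hγ
  obtain ⟨htop, T, hT, hTN, hTs⟩ := hpair.exists_bounded (r := r) fun l hl => by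
    by_contra hreg
    obtain ⟨t, ht⟩ := hcurve l hreg
    have h0 : halfPlanePart 0 = 0 := by simp [halfPlanePart]; rfl
    have := norm_halfPlanePart_sub_le (γ t) 0
    rw [h0, sub_zero, sub_zero, ← ht, norm_upperFold] at this
    exact absurd (this.trans (hr t t.2)) (not_le.2 hl)
  have hdom : N.dom = Set.univ := by
    have := congrArg (fun W : Submodule ℂ Hsp => (W : Set Hsp)) htop
    exact this
  refine ⟨hdom, T, ?_⟩
  obtain ⟨v, C, hC, hv, hlip⟩ := hγ'.exists_lipschitz_parameter
  obtain ⟨P, R, R', hP⟩ := exists_isSpectralSplitting T isQuatStructure_rsmul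
    (fun x => by rw [hTN, hTN, (hlin.2.2 x (hdom ▸ Set.mem_univ x) unitJ).2])
    (fun t : Set.Icc (0 : ℝ) 1 => halfPlanePart (γ t)) v hv hC
    (fun s t => (norm_halfPlanePart_sub_le _ _).trans (by rw [← dist_eq_norm]; exact hlip s t))
    (fun z hz => hcurve z (hTs z hz))
  obtain ⟨g, l, d, h⟩ := hP.exists_quasi_eigenvectors isQuatStructure_rsmul
    (u := TopologicalSpace.denseSeq Hsp)
      ((TopologicalSpace.denseRange_denseSeq Hsp).mono Submodule.subset_span) hδ
  exact ⟨g, l, d, hTN, h⟩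

lemma qinner_single (n : ℕ) (a : Hq) (y : Hsp) :
    qinner (lp.single 2 n a : Hsp) y = star a * y n := by
  rw [qinner, tsum_eq_single n fun k hk => ?_]
  · rw [lp.single_apply_self]
  · rw [lp.single_apply_ne _ _ _ hk, star_zero, zero_mul]

lemma not_finiteDimensional_Hsp : ¬FiniteDimensional ℂ Hsp := by
  intro hfin
  have ho : Orthonormal ℂ fun n : ℕ => (lp.single 2 n 1 : Hsp) := by
    rw [orthonormal_iff_ite]
    intro i j
    rw [inner_eq_complexPart, qinner_single, star_one, one_mul]
    split_ifs with h
    · subst h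
      rw [lp.single_apply_self]
      rfl
    · rw [lp.single_apply_ne _ _ _ h]
      rfl
  exact not_finite_iff_infinite.2 inferInstance ho.linearIndependent.finite

/-- A family which is orthonormal together with its image under the quaternionic structure. -/
structure IsQuatOrthonormal (e : ℕ → Hsp) : Prop where
  inner_self : ∀ r s, (inner ℂ (e r) (e s) : ℂ) = if r = s then 1 else 0
  inner_map : ∀ r s, (inner ℂ (e r) (rsmul unitJ (e s)) : ℂ) = 0

/-- A family of vectors together with its image under the quaternionic structure. -/
def doubledFamily (e : ℕ → Hsp) (p : ℕ × Bool) : Hsp := cond p.2 (rsmul unitJ (e p.1)) (e p.1)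

namespace IsQuatOrthonormal

variable {e : ℕ → Hsp}

lemma qinner_eq_ite (he : IsQuatOrthonormal e) (r s : ℕ) :
    qinner (e r) (e s) = if r = s then 1 else 0 := by
  rw [qinner_eq, he.inner_self, he.inner_map]
  split_ifs <;> simp

lemma orthonormal_doubledFamily (he : IsQuatOrthonormal e) : Orthonormal ℂ (doubledFamily e) := by
  rw [orthonormal_iff_ite]
  rintro ⟨r, a⟩ ⟨s, b⟩
  cases a <;> cases b
  · simpa [doubledFamily] using he.inner_self r s
  · simpa [doubledFamily] using he.inner_map r s
  · have : (inner ℂ (rsmul unitJ (e r)) (e s) : ℂ) = 0 := by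
      rw [← inner_conj_symm, he.inner_map, map_zero]
    simpa [doubledFamily] using this
  · simpa [doubledFamily, he.inner_self, eq_comm] using isQuatStructure_rsmul.inner_map (e r) (e s)

end IsQuatOrthonormal

lemma coeComplex_mul_unitJ (w : ℂ) : (w : Hq) * unitJ = unitJ * ((starRingEnd ℂ w : ℂ) : Hq) := by
  ext <;> simp

lemma rsmul_qinner (u w x : Hsp) :
    rsmul (qinner u x) w = (inner ℂ u x : ℂ) • w +
      (inner ℂ (rsmul unitJ u) x : ℂ) • rsmul unitJ w := by
  have h : (inner ℂ (rsmul unitJ u) x : ℂ) = -starRingEnd ℂ (inner ℂ u (rsmul unitJ x)) := by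
    rw [isQuatStructure_rsmul.inner_left, inner_conj_symm]
  rw [qinner_eq, coeComplex_mul_unitJ, sub_eq_add_neg, add_rsmul, neg_rsmul, rsmul_mul, h,
    neg_smul]
  rfl

lemma norm_qinner_sq (u x : Hsp) :
    ‖qinner u x‖ ^ 2 = ‖(inner ℂ u x : ℂ)‖ ^ 2 + ‖(inner ℂ (rsmul unitJ u) x : ℂ)‖ ^ 2 := by
  have h : ‖(inner ℂ (rsmul unitJ u) x : ℂ)‖ = ‖(inner ℂ u (rsmul unitJ x) : ℂ)‖ := by
    rw [isQuatStructure_rsmul.inner_left, norm_neg, norm_inner_symm]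
  rw [h, qinner_eq]
  generalize (inner ℂ u x : ℂ) = z
  generalize (inner ℂ u (rsmul unitJ x) : ℂ) = w
  rw [← Complex.normSq_eq_norm_sq, ← Complex.normSq_eq_norm_sq, Complex.normSq_apply,
    Complex.normSq_apply, pow_two, ← Quaternion.normSq_eq_norm_mul_self, Quaternion.normSq_def']
  simp
  ring

namespace IsQuatOrthonormal

variable {e : ℕ → Hsp}

lemma isONBasisOn (he : IsQuatOrthonormal e)
    (hZ : ∀ Z : Submodule ℂ Hsp, IsClosed (Z : Set Hsp) → (∀ y ∈ Z, rsmul unitJ y ∈ Z) →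
      (∀ i, e i ∈ Z) → Z = ⊤) : IsONBasisOn Set.univ e := by
  refine ⟨fun _ => Set.mem_univ _, he.qinner_eq_ite, fun x _ => ?_⟩
  have hsub : ∀ p, doubledFamily e p ∈ Submodule.span ℂ (Set.range (doubledFamily e)) :=
    fun p => Submodule.subset_span (Set.mem_range_self p)
  have hmap : ∀ y ∈ Submodule.span ℂ (Set.range (doubledFamily e)),
      rsmul unitJ y ∈ Submodule.span ℂ (Set.range (doubledFamily e)) := by
    refine fun y hy => isQuatStructure_rsmul.map_mem_span ?_ hy
    rintro _ ⟨⟨r, b⟩, rfl⟩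
    cases b
    · exact hsub (r, true)
    · have : rsmul unitJ (doubledFamily e (r, true)) = -doubledFamily e (r, false) :=
        isQuatStructure_rsmul.sq _
      rw [this]
      exact neg_mem (hsub _)
  have htop := hZ (Submodule.span ℂ (Set.range (doubledFamily e))).topologicalClosure
    (Submodule.isClosed_topologicalClosure _)
    (fun y hy => map_mem_closure isQuatStructure_rsmul.continuous hy hmap)
    (fun i => Submodule.le_topologicalClosure _ (hsub (i, false)))
  have h1 := (HilbertBasis.mk he.orthonormal_doubledFamily htop.ge).hasSum_repr x
  simp only [HilbertBasis.repr_apply_apply, HilbertBasis.coe_mk] at h1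
  refine h1.prod_fiberwise fun r => ?_
  convert hasSum_fintype _ using 1
  rw [rsmul_qinner, Fintype.sum_bool, add_comm]
  rfl

lemma sum_norm_qinner_sq_le (he : IsQuatOrthonormal e) (x : Hsp) (s : Finset ℕ) :
    ∑ r ∈ s, ‖qinner (e r) x‖ ^ 2 ≤ ‖x‖ ^ 2 := by
  have h := he.orthonormal_doubledFamily.sum_inner_products_le x (s := s ×ˢ Finset.univ)
  rw [Finset.sum_product] at h
  refine le_of_eq_of_le (Finset.sum_congr rfl fun r _ => ?_) h
  rw [norm_qinner_sq, Fintype.sum_bool, add_comm]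
  rfl

variable {w : ℕ → Hsp}

lemma norm_sum_rsmul_le (he : IsQuatOrthonormal e) (hw : Summable fun r => ‖w r‖ ^ 2) (x : Hsp)
    (s : Finset ℕ) :
    ∑ r ∈ s, ‖rsmul (qinner (e r) x) (w r)‖ ≤ √(∑' r, ‖w r‖ ^ 2) * ‖x‖ := by
  have h1 := Finset.sum_mul_sq_le_sq_mul_sq s (fun r => ‖w r‖) (fun r => ‖qinner (e r) x‖)
  simp only [← norm_rsmul] at h1
  have h2 : ∑ r ∈ s, ‖w r‖ ^ 2 ≤ ∑' r, ‖w r‖ ^ 2 := hw.sum_le_tsum _ fun _ _ => by positivity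
  have h0 : 0 ≤ ∑' r, ‖w r‖ ^ 2 := tsum_nonneg fun _ => by positivity
  refine le_of_sq_le_sq ?_ (by positivity)
  rw [mul_pow, Real.sq_sqrt h0]
  exact h1.trans (mul_le_mul h2 (he.sum_norm_qinner_sq_le x s)
    (Finset.sum_nonneg fun _ _ => by positivity) h0)

lemma summable_norm_rsmul (he : IsQuatOrthonormal e) (hw : Summable fun r => ‖w r‖ ^ 2)
    (x : Hsp) : Summable fun r => ‖rsmul (qinner (e r) x) (w r)‖ :=
  summable_of_sum_le (fun _ => norm_nonneg _) (he.norm_sum_rsmul_le hw x)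

/-- A square summable family is the image of an orthonormal family under a bounded operator. -/
lemma exists_isBoundedRightLinear (he : IsQuatOrthonormal e)
    (hw : Summable fun r => ‖w r‖ ^ 2) :
    ∃ S : Hsp → Hsp, IsBoundedRightLinear S ∧ ∀ r, S (e r) = w r := by
  have hs := fun x => (he.summable_norm_rsmul hw x).of_norm
  refine ⟨fun x => ∑' r, rsmul (qinner (e r) x) (w r), ⟨fun x y => ?_, fun q x => ?_,
    √(∑' r, ‖w r‖ ^ 2), fun x => ?_⟩, fun s => ?_⟩
  · rw [← (hs x).tsum_add (hs y)]
    simp only [qinner_add_right, add_rsmul]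
  · simp only [qinner_rsmul_right, rsmul_mul]
    exact (hs x).tsum_const_smul (MulOpposite.op q)
  · exact (norm_tsum_le_tsum_norm (he.summable_norm_rsmul hw x)).trans
      (Real.tsum_le_of_sum_le (fun _ => norm_nonneg _) (he.norm_sum_rsmul_le hw x))
  · beta_reduce
    rw [tsum_eq_single s fun r hr => ?_]
    · rw [he.qinner_eq_ite, if_pos rfl, one_rsmul]
    · rw [he.qinner_eq_ite, if_neg hr, zero_rsmul]

end IsQuatOrthonormal

lemma exists_equiv_support {g : ℕ → Hsp}
    (hZ : ∀ Z : Submodule ℂ Hsp, IsClosed (Z : Set Hsp) → (∀ y ∈ Z, rsmul unitJ y ∈ Z) →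
      (∀ i, g i ∈ Z) → Z = ⊤) : Nonempty (ℕ ≃ {i // g i ≠ 0}) := by
  have : Infinite {i // g i ≠ 0} := by
    by_contra hinf
    have hfin : {i | g i ≠ 0}.Finite := Set.finite_coe_iff.1 (not_infinite_iff_finite.1 hinf)
    set F : Set Hsp := g '' {i | g i ≠ 0} ∪ rsmul unitJ '' (g '' {i | g i ≠ 0}) with hF
    have hFfin : F.Finite := (hfin.image _).union ((hfin.image _).image _)
    have : FiniteDimensional ℂ (Submodule.span ℂ F) := FiniteDimensional.span_of_finite ℂ hFfin
    have htop := hZ (Submodule.span ℂ F) (Submodule.closed_of_finiteDimensional _)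
      (fun y hy => ?_) fun i => ?_
    · rw [htop] at this
      exact not_finiteDimensional_Hsp (Module.finite_def.2 (Submodule.fg_top _ |>.1 this.fg_top))
    · refine isQuatStructure_rsmul.map_mem_span ?_ hy
      rintro y (hy | ⟨y, hy, rfl⟩)
      · exact Submodule.subset_span (Or.inr ⟨y, hy, rfl⟩)
      · rw [isQuatStructure_rsmul.sq]
        exact neg_mem (Submodule.subset_span (Or.inl hy))
    · by_cases hi : g i = 0
      · rw [hi]; exact zero_mem _
      · exact Submodule.subset_span (Or.inl ⟨i, hi, rfl⟩)
  exact nonempty_equiv_of_countable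

/-- Normalization of an orthogonal total family. -/
lemma exists_isQuatOrthonormal {g : ℕ → Hsp}
    (horth : ∀ i k, i ≠ k → (inner ℂ (g i) (g k) : ℂ) = 0 ∧
      (inner ℂ (g i) (rsmul unitJ (g k)) : ℂ) = 0)
    (hZ : ∀ Z : Submodule ℂ Hsp, IsClosed (Z : Set Hsp) → (∀ y ∈ Z, rsmul unitJ y ∈ Z) →
      (∀ i, g i ∈ Z) → Z = ⊤) :
    ∃ (e : ℕ → Hsp) (φ : ℕ → ℕ), IsQuatOrthonormal e ∧ IsONBasisOn Set.univ e ∧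
      Function.Injective φ ∧ ∀ r, g (φ r) ≠ 0 ∧ e r = ((‖g (φ r)‖⁻¹ : ℝ) : ℂ) • g (φ r) := by
  obtain ⟨ψ⟩ := exists_equiv_support hZ
  set φ : ℕ → ℕ := fun r => ψ r with hφ
  have hinj : Function.Injective φ := Subtype.val_injective.comp ψ.injective
  have hne : ∀ r, g (φ r) ≠ 0 := fun r => (ψ r).2
  set e : ℕ → Hsp := fun r => ((‖g (φ r)‖⁻¹ : ℝ) : ℂ) • g (φ r) with he
  have hQ : IsQuatOrthonormal e := by
    refine ⟨fun r s => ?_, fun r s => ?_⟩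
    · simp only [he]
      rw [inner_smul_left, inner_smul_right]
      split_ifs with h
      · subst h
        rw [inner_self_eq_norm_sq_to_K]
        have : (‖g (φ r)‖ : ℂ) ≠ 0 := by exact_mod_cast norm_ne_zero_iff.2 (hne r)
        simp
        field_simp
      · rw [(horth _ _ (hinj.ne h)).1]; simp
    · simp only [he]
      rw [isQuatStructure_rsmul.map_smul, inner_smul_left, inner_smul_right]
      rcases eq_or_ne r s with h | h
      · rw [h, isQuatStructure_rsmul.inner_self_map]; simp
      · rw [(horth _ _ (hinj.ne h)).2]; simp
  refine ⟨e, φ, hQ, hQ.isONBasisOn fun Z hc hJ hmem => hZ Z hc hJ fun i => ?_, hinj,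
    fun r => ⟨hne r, rfl⟩⟩
  by_cases hi : g i = 0
  · rw [hi]; exact zero_mem _
  · have h1 : φ (ψ.symm ⟨i, hi⟩) = i := by simp [hφ]
    have h2 := Z.smul_mem (‖g i‖ : ℂ) (hmem (ψ.symm ⟨i, hi⟩))
    simp only [he, h1, smul_smul] at h2
    rwa [← Complex.ofReal_mul, mul_inv_cancel₀ (norm_ne_zero_iff.2 hi), Complex.ofReal_one,
      one_smul] at h2

/-- Let `N ∈ C(H)` be normal with `σ_S(N) = Ω_K`, where `K` is a
subset of a rectifiable curve in `ℂ_m⁺`. Then for every `ε > 0` there are a diagonal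
operator `D` with `D(D) = D(N)` and a Hilbert–Schmidt `S ∈ B(H)` with `‖S‖₂ < ε` such
that `N = D + S` on `D(N)`. -/
theorem wvnb_unbounded_hilbertSchmidt (m : Hq) (hm : m ∈ QS)
    (N : QOp) (hlin : N.IsRightLinear) (hdense : N.IsDenselyDefined)
    (hclosed : N.IsClosedOp) (hnormal : N.IsNormal)
    (K : Set Hq)
    (hKcurve : ∃ γ : ℝ → Hq, ContinuousOn γ (Set.Icc 0 1) ∧
      BoundedVariationOn γ (Set.Icc 0 1) ∧ γ '' Set.Icc 0 1 ⊆ sliceCplus m ∧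
      K ⊆ γ '' Set.Icc 0 1)
    (hspec : sphSpectrumU N = circ m K)
    (ε : ℝ) (hε : 0 < ε) :
    ∃ D : QOp, D.IsRightLinear ∧ D.dom = N.dom ∧ D.IsDiagonal ∧
      ∃ S : Hsp → Hsp, IsBoundedRightLinear S ∧
        (∃ v : ℝ, HasHSNormSqOn S Set.univ v ∧ Real.sqrt v < ε) ∧
        ∀ x ∈ N.dom, N.app x = D.app x + S x := by
  obtain ⟨γ, hγ, hγ', -, hK⟩ := hKcurve
  obtain ⟨hdom, T, g, l, d, hTN, horth, hZ, hTg, hd, hdε⟩ :=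
    exists_quasi_eigenvectors_of_sphSpectrumU hm hlin hdense hclosed hnormal hγ hγ' hK hspec
      (pow_pos hε 2)
  obtain ⟨e, φ, he, hbasis, hinj, hφ⟩ := exists_isQuatOrthonormal horth hZ
  set w : ℕ → Hsp := fun r => T (e r) - l (φ r) • e r with hw
  have hwd : ∀ r, ‖w r‖ ^ 2 ≤ d (φ r) ^ 2 := fun r => by
    have hpos : 0 < ‖g (φ r)‖ := norm_pos_iff.2 (hφ r).1
    have h1 : w r = ((‖g (φ r)‖⁻¹ : ℝ) : ℂ) • (T (g (φ r)) - l (φ r) • g (φ r)) := by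
      simp only [hw, (hφ r).2, map_smul]
      module
    have h2 : ‖w r‖ ≤ d (φ r) := by
      rw [h1, norm_smul, Complex.norm_real, norm_inv, norm_norm, inv_mul_le_iff₀ hpos, mul_comm]
      exact hTg _
    exact pow_le_pow_left₀ (norm_nonneg _) h2 2
  have hdφ : Summable fun r => d (φ r) ^ 2 := hd.comp_injective hinj
  have hws : Summable fun r => ‖w r‖ ^ 2 :=
    Summable.of_nonneg_of_le (fun _ => by positivity) hwd hdφ
  have hwε : ∑' r, ‖w r‖ ^ 2 < ε ^ 2 := by
    refine ((hws.tsum_le_tsum hwd hdφ).trans ?_).trans_lt hdε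
    exact tsum_comp_le_tsum_of_inj hd (fun _ => by positivity) hinj
  obtain ⟨S, hS, hSe⟩ := he.exists_isBoundedRightLinear hws
  refine ⟨⟨N.dom, fun x => N.app x - S x⟩, ⟨hlin.1, fun x hx y hy => ⟨(hlin.2.1 x hx y hy).1, ?_⟩,
    fun x hx q => ⟨(hlin.2.2 x hx q).1, ?_⟩⟩, rfl, ⟨e, hbasis, fun r => hdom ▸ Set.mem_univ _,
    fun r => (l (φ r) : Hq), fun r => ?_⟩, S, hS,
    ⟨∑' r, ‖w r‖ ^ 2, ⟨e, hbasis, ?_⟩, ?_⟩, fun x _ => ?_⟩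
  · simp only [(hlin.2.1 x hx y hy).2, hS.1]
    abel
  · simp only [(hlin.2.2 x hx q).2, hS.2.1]
    exact (smul_sub _ _ _).symm
  · simp only [hSe, hw, hTN]
    exact sub_sub_cancel _ _
  · simpa only [hSe] using hws.hasSum
  · exact (Real.sqrt_lt' hε).2 hwε
  · exact (sub_add_cancel _ _).symm
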